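/- arXiv:2509.10013 — 2 statements merged into one kernel-verified Lean document; each statement's English description precedes it below -/
import Mathlib

section
/- Suppose Φ is a meromorphic function on ℂ which is doubly periodic with respect to Λ_τ (Φ(z+1) = Φ(z) and Φ(z+τ) = Φ(z)) and which satisfies Φ''' − 4 q(·;A) Φ' − 2 q'(·;A) Φ = 0 on ℂ minus S and the poles of Φ. Then there exists a constant k ∈ ℂ such that Φ(z) = k · Φ_e(z;A) for all z where both sides are defined. -/
open Complex Filter Topology

noncomputable section

/-- The lattice `Λ_τ = ℤ + τℤ`. -/
def Lam (τ : ℂ) : Set ℂ := {ω | ∃ m n : ℤ, ω = (m : ℂ) + (n : ℂ) * τ}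

/-- The nonzero lattice points. -/
def Lam' (τ : ℂ) : Set ℂ := {ω | ω ∈ Lam τ ∧ ω ≠ 0}

/-- The Weierstrass elliptic function `℘(z; τ)`. -/
def wp (τ z : ℂ) : ℂ :=
  1 / z ^ 2 + ∑' ω : Lam' τ, (1 / (z - (ω : ℂ)) ^ 2 - 1 / (ω : ℂ) ^ 2)

/-- The Weierstrass zeta function `ζ(z; τ)`. -/
def wzeta (τ z : ℂ) : ℂ :=
  1 / z + ∑' ω : Lam' τ, (1 / (z - (ω : ℂ)) + 1 / (ω : ℂ) + z / (ω : ℂ) ^ 2)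

/-- The Weierstrass sigma function `σ(z; τ)`. -/
def wsigma (τ z : ℂ) : ℂ :=
  z * ∏' ω : Lam' τ,
    ((1 - z / (ω : ℂ)) * Complex.exp (z / (ω : ℂ) + z ^ 2 / (2 * (ω : ℂ) ^ 2)))

/-- `℘'(z; τ)`. -/
def wpd (τ : ℂ) : ℂ → ℂ := deriv (wp τ)

/-- `℘''(z; τ)`. -/
def wpdd (τ : ℂ) : ℂ → ℂ := deriv (deriv (wp τ))

/-- The constant `B(A)`. -/
def Bc (τ p A : ℂ) : ℂ :=
  A ^ 2 - wzeta τ (2 * p) * A - 3 / 4 * wp τ (2 * p) - 2 * wp τ p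

/-- The potential `q(z; A)`. -/
def qpot (τ p A z : ℂ) : ℂ :=
  2 * wp τ z + 3 / 4 * (wp τ (z + p) + wp τ (z - p))
    + A * (wzeta τ (z + p) - wzeta τ (z - p)) + Bc τ p A

/-- The singular set `S = Λ_τ ∪ (p + Λ_τ) ∪ (−p + Λ_τ)`. -/
def Sset (τ p : ℂ) : Set ℂ :=
  Lam τ ∪ {z | z - p ∈ Lam τ} ∪ {z | z + p ∈ Lam τ}

/-- The unique elliptic solution `Φ_e(z; A)` of the second symmetric product equation. -/
def Phie (τ p A z : ℂ) : ℂ :=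
  wp τ z + (A / 2 - 3 * wpdd τ p / (8 * wpd τ p)) * (wzeta τ (z + p) - wzeta τ (z - p))
    - A ^ 2 + (wpdd τ p / (2 * wpd τ p) - wzeta τ p) * A
    - wp τ p + 3 / 4 * (wpdd τ p / wpd τ p) * wzeta τ p
    + 3 / 16 * (wpdd τ p ^ 2 / wpd τ p ^ 2)

/-- The cubic factor `Y₁(A)`. -/
def Y1 (τ p A : ℂ) : ℂ :=
  A ^ 3 - 5 * wpdd τ p / (4 * wpd τ p) * A ^ 2
    + 3 * (wp τ p + wpdd τ p ^ 2 / (16 * wpd τ p ^ 2)) * A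
    + wpd τ p / 2 - 9 * wpdd τ p / (4 * wpd τ p) * wp τ p
    + 9 / 64 * (wpdd τ p ^ 3 / wpd τ p ^ 3)

/-- The cubic factor `Y₂(A)`. -/
def Y2 (τ p A : ℂ) : ℂ :=
  A ^ 3 - wpdd τ p / (4 * wpd τ p) * A ^ 2
    - 5 / 16 * (wpdd τ p ^ 2 / wpd τ p ^ 2) * A
    + 2 * wpd τ p - 3 / 64 * (wpdd τ p ^ 3 / wpd τ p ^ 3)

/-! ### The period lattice -/

/-- The period pair `(1, τ)`. -/
def periodPair (τ : ℂ) (hτ : 0 < τ.im) : PeriodPair where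
  ω₁ := 1
  ω₂ := τ
  indep := by
    rw [LinearIndependent.pair_iff]
    intro s t h
    have h2 := congrArg Complex.im h
    have h1 := congrArg Complex.re h
    simp at h1 h2
    have ht : t = 0 := by
      rcases h2 with h2 | h2
      · exact h2
      · exact absurd h2 hτ.ne'
    subst ht
    simpa using h1

lemma mem_periodPair_lattice {τ : ℂ} (hτ : 0 < τ.im) {x : ℂ} :
    x ∈ (periodPair τ hτ).lattice ↔ x ∈ Lam τ := by
  rw [PeriodPair.mem_lattice]
  simp only [periodPair, mul_one, Lam, Set.mem_ofPred_eq, eq_comm]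

lemma coe_periodPair_lattice {τ : ℂ} (hτ : 0 < τ.im) :
    ((periodPair τ hτ).lattice : Set ℂ) = Lam τ := by
  ext x; exact mem_periodPair_lattice hτ

lemma zero_mem_Lam (τ : ℂ) : (0 : ℂ) ∈ Lam τ := ⟨0, 0, by simp⟩

lemma one_mem_Lam (τ : ℂ) : (1 : ℂ) ∈ Lam τ := ⟨1, 0, by simp⟩

lemma tau_mem_Lam (τ : ℂ) : τ ∈ Lam τ := ⟨0, 1, by simp⟩

lemma add_mem_Lam {τ x y : ℂ} (hx : x ∈ Lam τ) (hy : y ∈ Lam τ) : x + y ∈ Lam τ := by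
  obtain ⟨a, b, rfl⟩ := hx
  obtain ⟨c, d, rfl⟩ := hy
  exact ⟨a + c, b + d, by push_cast; ring⟩

lemma neg_mem_Lam {τ x : ℂ} (hx : x ∈ Lam τ) : -x ∈ Lam τ := by
  obtain ⟨a, b, rfl⟩ := hx
  exact ⟨-a, -b, by push_cast; ring⟩

lemma neg_mem_Lam_iff {τ x : ℂ} : -x ∈ Lam τ ↔ x ∈ Lam τ :=
  ⟨fun h => by simpa using neg_mem_Lam h, neg_mem_Lam⟩

lemma sub_mem_Lam {τ x y : ℂ} (hx : x ∈ Lam τ) (hy : y ∈ Lam τ) : x - y ∈ Lam τ := by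
  rw [sub_eq_add_neg]; exact add_mem_Lam hx (neg_mem_Lam hy)

lemma add_mem_Lam_iff {τ x l : ℂ} (hl : l ∈ Lam τ) : x + l ∈ Lam τ ↔ x ∈ Lam τ :=
  ⟨fun h => by simpa using sub_mem_Lam h hl, fun h => add_mem_Lam h hl⟩

lemma Lam'_eq (τ : ℂ) : Lam' τ = Lam τ \ {0} := rfl

lemma isOpen_compl_Lam {τ : ℂ} (hτ : 0 < τ.im) : IsOpen (Lam τ)ᶜ := by
  rw [← coe_periodPair_lattice hτ]
  exact (periodPair τ hτ).isClosed_lattice.isOpen_compl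

lemma isOpen_compl_Lam' {τ : ℂ} (hτ : 0 < τ.im) : IsOpen (Lam' τ)ᶜ := by
  rw [Lam'_eq, ← coe_periodPair_lattice hτ]
  exact (periodPair τ hτ).isOpen_compl_lattice_sdiff

lemma countable_Lam (τ : ℂ) : (Lam τ).Countable := by
  have : Lam τ = Set.range (fun x : ℤ × ℤ => (x.1 : ℂ) + (x.2 : ℂ) * τ) := by
    ext x; simp [Lam, eq_comm]
  rw [this]; exact Set.countable_range _

lemma isPreconnected_compl_Lam (τ : ℂ) : IsPreconnected (Lam τ)ᶜ :=
  ((countable_Lam τ).isConnected_compl_of_one_lt_rank (by simp)).isPreconnected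

lemma eventually_notMem_Lam {τ : ℂ} (hτ : 0 < τ.im) (z : ℂ) : ∀ᶠ w in 𝓝[≠] z, w ∉ Lam τ := by
  have h : (Lam τ \ {z})ᶜ ∈ 𝓝 z := by
    rw [← coe_periodPair_lattice hτ]
    exact (periodPair τ hτ).compl_lattice_sdiff_singleton_mem_nhds z
  filter_upwards [nhdsWithin_le_nhds h, self_mem_nhdsWithin] with w hw hne hmem
  exact hw ⟨hmem, hne⟩

/-! ### The regular parts of `℘` and `ζ` at the origin -/

/-- `℘(z) - 1/z²`. -/
def wpReg (τ z : ℂ) : ℂ := ∑' ω : Lam' τ, (1 / (z - (ω : ℂ)) ^ 2 - 1 / (ω : ℂ) ^ 2)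

/-- `ζ(z) - 1/z`. -/
def wzetaReg (τ z : ℂ) : ℂ :=
  ∑' ω : Lam' τ, (1 / (z - (ω : ℂ)) + 1 / (ω : ℂ) + z / (ω : ℂ) ^ 2)

lemma wp_eq (τ z : ℂ) : wp τ z = 1 / z ^ 2 + wpReg τ z := rfl

lemma wzeta_eq (τ z : ℂ) : wzeta τ z = 1 / z + wzetaReg τ z := rfl

lemma tsum_Lam' {τ : ℂ} (hτ : 0 < τ.im) (f : ℂ → ℂ) :
    ∑' ω : Lam' τ, f ω = ∑' l : (periodPair τ hτ).lattice, if (l : ℂ) = 0 then 0 else f l := by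
  have h1 := tsum_subtype (Lam' τ) f
  have h2 := tsum_subtype ((periodPair τ hτ).lattice : Set ℂ)
    (fun l : ℂ => if l = 0 then 0 else f l)
  refine h1.trans (Eq.trans ?_ h2.symm)
  congr 1
  ext x
  by_cases hx : x = 0 <;> by_cases hm : x ∈ Lam τ <;>
    simp [Set.indicator, Lam', mem_periodPair_lattice hτ, hx, hm]

lemma wpReg_eq {τ : ℂ} (hτ : 0 < τ.im) : wpReg τ = (periodPair τ hτ).weierstrassPExcept 0 := by
  ext z
  exact tsum_Lam' hτ (fun ω => 1 / (z - ω) ^ 2 - 1 / ω ^ 2)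

lemma wp_eq_weierstrassP {τ : ℂ} (hτ : 0 < τ.im) : wp τ = (periodPair τ hτ).weierstrassP := by
  ext z
  have := (periodPair τ hτ).weierstrassPExcept_add 0 z
  rw [wp_eq, wpReg_eq hτ, ← this]
  simp [add_comm]

lemma wp_add {τ l : ℂ} (hτ : 0 < τ.im) (hl : l ∈ Lam τ) (z : ℂ) : wp τ (z + l) = wp τ z := by
  rw [wp_eq_weierstrassP hτ]
  exact (periodPair τ hτ).weierstrassP_add_coe z ⟨l, (mem_periodPair_lattice hτ).2 hl⟩

lemma wpReg_neg {τ : ℂ} (hτ : 0 < τ.im) (z : ℂ) : wpReg τ (-z) = wpReg τ z := by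
  rw [wpReg_eq hτ]
  simpa using (periodPair τ hτ).weierstrassPExcept_neg 0 z

lemma wp_neg {τ : ℂ} (hτ : 0 < τ.im) (z : ℂ) : wp τ (-z) = wp τ z := by
  simp [wp_eq, wpReg_neg hτ]

lemma wpReg_zero {τ : ℂ} (hτ : 0 < τ.im) : wpReg τ 0 = 0 := by
  rw [wpReg_eq hτ]; simp

lemma wzetaReg_neg (τ z : ℂ) : wzetaReg τ (-z) = -wzetaReg τ z := by
  let e : Lam' τ ≃ Lam' τ :=
    { toFun := fun ω => ⟨-ω, neg_mem_Lam ω.2.1, neg_ne_zero.2 ω.2.2⟩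
      invFun := fun ω => ⟨-ω, neg_mem_Lam ω.2.1, neg_ne_zero.2 ω.2.2⟩
      left_inv := fun ω => by simp
      right_inv := fun ω => by simp }
  rw [wzetaReg, wzetaReg, ← e.tsum_eq, ← tsum_neg]
  congr 1
  ext ω
  have hω : ((e ω : Lam' τ) : ℂ) = -ω := rfl
  rw [hω]
  have : -z - -(ω : ℂ) = -(z - ω) := by ring
  rw [this]
  simp only [div_neg, neg_sq, neg_div]
  ring

lemma wzetaReg_zero (τ : ℂ) : wzetaReg τ 0 = 0 := by
  have := wzetaReg_neg τ 0
  rw [neg_zero] at this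
  linear_combination this / 2

lemma wzeta_neg (τ z : ℂ) : wzeta τ (-z) = -wzeta τ z := by
  simp only [wzeta_eq, wzetaReg_neg, div_neg]; ring

lemma analyticAt_wpReg {τ z : ℂ} (hτ : 0 < τ.im) (hz : z ∉ Lam' τ) :
    AnalyticAt ℂ (wpReg τ) z := by
  have h := (periodPair τ hτ).analyticOnNhd_weierstrassPExcept 0
  rw [coe_periodPair_lattice, ← Lam'_eq, ← wpReg_eq hτ] at h
  exact h z hz

lemma norm_zeta_term_le {r : ℝ} {s l : ℂ} (hr : 0 < r) (hs : ‖s‖ < r) (h : 2 * r ≤ ‖l‖) :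
    ‖1 / (s - l) + 1 / l + s / l ^ 2‖ ≤ 2 * r ^ 2 * ‖l‖ ^ (-3 : ℝ) := by
  have hl : 0 < ‖l‖ := by linarith
  have hl0 : l ≠ 0 := norm_pos_iff.1 hl
  have hsl : ‖l‖ / 2 ≤ ‖s - l‖ := by
    rw [norm_sub_rev]
    exact .trans (by linarith) (norm_sub_norm_le l s)
  have hsl0 : s - l ≠ 0 := norm_pos_iff.1 (by linarith)
  have : 1 / (s - l) + 1 / l + s / l ^ 2 = s ^ 2 / (l ^ 2 * (s - l)) := by
    field_simp; ring
  rw [this, norm_div, norm_mul, norm_pow, norm_pow]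
  calc ‖s‖ ^ 2 / (‖l‖ ^ 2 * ‖s - l‖) ≤ r ^ 2 / (‖l‖ ^ 2 * (‖l‖ / 2)) := by gcongr
    _ = 2 * r ^ 2 / ‖l‖ ^ 3 := by field
    _ = _ := by norm_cast

lemma hasSumLocallyUniformly_wzetaReg {τ : ℂ} (hτ : 0 < τ.im) :
    HasSumLocallyUniformly (fun (l : (periodPair τ hτ).lattice) (z : ℂ) =>
      if (l : ℂ) = 0 then 0 else 1 / (z - l) + 1 / (l : ℂ) + z / (l : ℂ) ^ 2) (wzetaReg τ) := by
  have he : wzetaReg τ = fun z => ∑' l : (periodPair τ hτ).lattice,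
      if (l : ℂ) = 0 then 0 else 1 / (z - l) + 1 / (l : ℂ) + z / (l : ℂ) ^ 2 := by
    ext z
    exact tsum_Lam' hτ (fun ω => 1 / (z - ω) + 1 / ω + z / ω ^ 2)
  rw [he]
  refine (periodPair τ hτ).hasSumLocallyUniformly_aux (u := fun r l => 2 * r ^ 2 * ‖l‖ ^ (-3 : ℝ)) _
    (fun _ _ ↦ (ZLattice.summable_norm_rpow _ _ (by simp; norm_num)).mul_left _) fun r hr ↦
    Filter.eventually_atTop.mpr ⟨2 * r, ?_⟩
  rintro _ h s hs l rfl
  split_ifs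
  · rw [norm_zero]; positivity
  · exact norm_zeta_term_le hr hs h

lemma hasDerivAt_zeta_term {z l : ℂ} (h : z ≠ l) :
    HasDerivAt (fun z : ℂ => 1 / (z - l) + 1 / l + z / l ^ 2)
      (-(1 / (z - l) ^ 2 - 1 / l ^ 2)) z := by
  have h0 : z - l ≠ 0 := sub_ne_zero.2 h
  have h1 : HasDerivAt (fun z : ℂ => (z - l)⁻¹) (-1 / (z - l) ^ 2) z :=
    ((hasDerivAt_id z).sub_const l).fun_inv h0
  have h2 := (h1.add_const (1 / l)).add ((hasDerivAt_id z).div_const (l ^ 2))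
  simp only [one_div] at h2 ⊢
  exact h2.congr_deriv (by simp only [div_eq_mul_inv]; ring)

lemma hasDerivAt_zeta_partialSum {τ z : ℂ} (hτ : 0 < τ.im) (hz : z ∉ Lam' τ)
    (s : Finset (periodPair τ hτ).lattice) :
    HasDerivAt (fun z : ℂ => ∑ l ∈ s,
        if (l : ℂ) = 0 then 0 else 1 / (z - l) + 1 / (l : ℂ) + z / (l : ℂ) ^ 2)
      (∑ l ∈ s, -(if (l : ℂ) = 0 then 0 else 1 / (z - l) ^ 2 - 1 / (l : ℂ) ^ 2)) z := by
  refine HasDerivAt.fun_sum fun l _ => ?_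
  split_ifs with h
  · simpa using hasDerivAt_const z (0 : ℂ)
  · refine hasDerivAt_zeta_term ?_
    rintro rfl
    exact hz ⟨(mem_periodPair_lattice hτ).1 l.2, h⟩

lemma analyticAt_wzetaReg {τ z : ℂ} (hτ : 0 < τ.im) (hz : z ∉ Lam' τ) :
    AnalyticAt ℂ (wzetaReg τ) z := by
  have h : DifferentiableOn ℂ (wzetaReg τ) (Lam' τ)ᶜ :=
    (hasSumLocallyUniformly_wzetaReg hτ).hasSumLocallyUniformlyOn.differentiableOn
      (.of_forall fun s w hw =>
        (hasDerivAt_zeta_partialSum hτ hw s).differentiableAt.differentiableWithinAt)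
      (isOpen_compl_Lam' hτ)
  exact h.analyticAt ((isOpen_compl_Lam' hτ).mem_nhds hz)

lemma deriv_wzetaReg {τ z : ℂ} (hτ : 0 < τ.im) (hz : z ∉ Lam' τ) :
    deriv (wzetaReg τ) z = -wpReg τ z := by
  have h1 := (hasSumLocallyUniformly_wzetaReg hτ).tendstoLocallyUniformlyOn (s := (Lam' τ)ᶜ)
  have h2 := h1.deriv (.of_forall fun s w hw =>
        (hasDerivAt_zeta_partialSum hτ hw s).differentiableAt.differentiableWithinAt)
      (isOpen_compl_Lam' hτ)
  have h3 := h2.tendsto_at hz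
  have h4 := ((periodPair τ hτ).hasSum_weierstrassPExcept 0 z).neg
  rw [← wpReg_eq hτ] at h4
  refine tendsto_nhds_unique h3 (h4.congr fun s => ?_)
  exact (hasDerivAt_zeta_partialSum hτ hz s).deriv.symm

lemma hasDerivAt_wzetaReg {τ z : ℂ} (hτ : 0 < τ.im) (hz : z ∉ Lam' τ) :
    HasDerivAt (wzetaReg τ) (-wpReg τ z) z := by
  rw [← deriv_wzetaReg hτ hz]
  exact (analyticAt_wzetaReg hτ hz).differentiableAt.hasDerivAt

lemma notMem_Lam'_of_notMem {τ z : ℂ} (hz : z ∉ Lam τ) : z ∉ Lam' τ := fun h => hz h.1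

lemma zero_notMem_Lam' (τ : ℂ) : (0 : ℂ) ∉ Lam' τ := fun h => h.2 rfl

lemma ne_zero_of_notMem_Lam {τ z : ℂ} (hz : z ∉ Lam τ) : z ≠ 0 := by
  rintro rfl; exact hz (zero_mem_Lam τ)

lemma analyticAt_wp {τ z : ℂ} (hτ : 0 < τ.im) (hz : z ∉ Lam τ) : AnalyticAt ℂ (wp τ) z := by
  have h0 := ne_zero_of_notMem_Lam hz
  have := analyticAt_wpReg hτ (notMem_Lam'_of_notMem hz)
  have h1 : AnalyticAt ℂ (fun z : ℂ => 1 / z ^ 2) z :=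
    analyticAt_const.div (analyticAt_id.pow 2) (pow_ne_zero 2 h0)
  exact h1.add this

lemma analyticAt_wzeta {τ z : ℂ} (hτ : 0 < τ.im) (hz : z ∉ Lam τ) :
    AnalyticAt ℂ (wzeta τ) z := by
  have h0 := ne_zero_of_notMem_Lam hz
  have := analyticAt_wzetaReg hτ (notMem_Lam'_of_notMem hz)
  have h1 : AnalyticAt ℂ (fun z : ℂ => 1 / z) z := analyticAt_const.div analyticAt_id h0
  exact h1.add this

lemma hasDerivAt_wzeta {τ z : ℂ} (hτ : 0 < τ.im) (hz : z ∉ Lam τ) :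
    HasDerivAt (wzeta τ) (-wp τ z) z := by
  have h0 := ne_zero_of_notMem_Lam hz
  have h2 := (hasDerivAt_inv h0).add (hasDerivAt_wzetaReg hτ (notMem_Lam'_of_notMem hz))
  have he : wzeta τ = (fun y : ℂ => y⁻¹) + wzetaReg τ := by
    ext y; simp [wzeta_eq]
  rw [he]
  exact h2.congr_deriv (by rw [wp_eq, one_div]; ring)

/-- The quasi-period of `ζ` attached to a lattice point. -/
lemma exists_quasiPeriod_wzeta {τ l : ℂ} (hτ : 0 < τ.im) (hl : l ∈ Lam τ) :
    ∃ c : ℂ, ∀ z ∉ Lam τ, wzeta τ (z + l) = wzeta τ z + c := by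
  have hd : ∀ z ∈ (Lam τ)ᶜ, HasDerivAt (fun z => wzeta τ (z + l) - wzeta τ z) 0 z := by
    intro z hz
    have hz' : z + l ∉ Lam τ := fun h => hz ((add_mem_Lam_iff hl).1 h)
    have h := ((hasDerivAt_wzeta hτ hz').comp_add_const z l).sub (hasDerivAt_wzeta hτ hz)
    rw [wp_add hτ hl, sub_self] at h
    exact h
  obtain ⟨c, hc⟩ := (isOpen_compl_Lam hτ).exists_is_const_of_deriv_eq_zero
    (isPreconnected_compl_Lam τ) (fun z hz => (hd z hz).differentiableAt.differentiableWithinAt)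
    (fun z hz => (hd z hz).deriv)
  exact ⟨c, fun z hz => by have := hc z hz; rw [← this]; ring⟩

/-! ### Removable singularities and quasi-periodic entire functions -/

lemma Filter.EventuallyEq.eventually_nhds_of_punctured {f g : ℂ → ℂ} {z₀ : ℂ}
    (h : f =ᶠ[𝓝[≠] z₀] g) : ∀ᶠ z in 𝓝[≠] z₀, f =ᶠ[𝓝 z] g :=
  eventually_nhdsNE_eventually_nhds_iff.2 h

lemma eq_of_punctured {f g : ℂ → ℂ} {z₀ : ℂ} (hf : ContinuousAt f z₀) (hg : ContinuousAt g z₀)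
    (h : f =ᶠ[𝓝[≠] z₀] g) : f z₀ = g z₀ :=
  ((hf.eventuallyEq_nhds_iff_eventuallyEq_nhdsNE hg).1 h).eq_of_nhds

lemma tendsto_add_right_punctured (z l : ℂ) :
    Tendsto (fun w => w + l) (𝓝[≠] z) (𝓝[≠] (z + l)) := by
  refine tendsto_nhdsWithin_of_tendsto_nhds_of_eventually_within _ ?_ ?_
  · exact ((continuous_id.add continuous_const).tendsto z).mono_left nhdsWithin_le_nhds
  · filter_upwards [self_mem_nhdsWithin] with w hw h
    exact hw (add_right_cancel h)

/-- `f` agrees near `z₀`, away from `z₀`, with a function analytic at `z₀`. -/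
def RemovableAt (f : ℂ → ℂ) (z₀ : ℂ) : Prop :=
  ∃ h : ℂ → ℂ, AnalyticAt ℂ h z₀ ∧ f =ᶠ[𝓝[≠] z₀] h

lemma AnalyticAt.removableAt {f : ℂ → ℂ} {z₀ : ℂ} (hf : AnalyticAt ℂ f z₀) : RemovableAt f z₀ :=
  ⟨f, hf, .rfl⟩

lemma RemovableAt.translate {f : ℂ → ℂ} {z₀ l t : ℂ} (hf : RemovableAt f z₀)
    (hper : ∀ᶠ w in 𝓝[≠] z₀, f (w + l) = f w + t) : RemovableAt f (z₀ + l) := by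
  obtain ⟨h, hh, hfh⟩ := hf
  refine ⟨fun w => h (w - l) + t, ?_, ?_⟩
  · refine AnalyticAt.add ?_ analyticAt_const
    exact AnalyticAt.fun_comp (by simpa using hh) (analyticAt_id.sub analyticAt_const)
  · have := (tendsto_add_right_punctured (z₀ + l) (-l))
    rw [add_neg_cancel_right] at this
    filter_upwards [this.eventually hper, this.eventually hfh] with w h1 h2
    rw [neg_add_cancel_right] at h1
    rw [h1, h2, sub_eq_add_neg]

lemma exists_entire_of_removableAt {f : ℂ → ℂ} (hf : ∀ z, RemovableAt f z) :
    ∃ E : ℂ → ℂ, Differentiable ℂ E ∧ ∀ z, f =ᶠ[𝓝[≠] z] E := by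
  choose h hh hfh using hf
  have key : ∀ z, (fun w => h w w) =ᶠ[𝓝 z] h z := by
    intro z
    have h1 : ∀ᶠ w in 𝓝[≠] z, h w w = h z w := by
      filter_upwards [(hfh z).eventually_nhds_of_punctured,
        nhdsWithin_le_nhds (hh z).eventually_analyticAt] with w hw haw
      exact eq_of_punctured (hh w).continuousAt haw.continuousAt
        ((hfh w).symm.trans (hw.filter_mono nhdsWithin_le_nhds))
    rw [eventually_nhdsWithin_iff] at h1
    filter_upwards [h1] with w hw
    by_cases hwz : w = z
    · rw [hwz]
    · exact hw hwz
  refine ⟨fun w => h w w, fun z => ?_, fun z => ?_⟩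
  · exact ((hh z).congr (key z).symm).differentiableAt
  · exact (hfh z).trans ((key z).symm.filter_mono nhdsWithin_le_nhds)

lemma exists_mem_parallelogram {τ : ℂ} (hτ : 0 < τ.im) (z : ℂ) :
    ∃ m n : ℤ, ∃ s ∈ Set.Icc (0 : ℝ) 1, ∃ t ∈ Set.Icc (0 : ℝ) 1,
      z = ((s : ℂ) + t * τ) + m * 1 + n * τ := by
  have hv : ∃ v u : ℝ, z = (u : ℂ) + v * τ := by
    refine ⟨z.im / τ.im, z.re - z.im / τ.im * τ.re, ?_⟩
    apply Complex.ext <;> simp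
    field_simp
  obtain ⟨v, u, rfl⟩ := hv
  refine ⟨⌊u⌋, ⌊v⌋, Int.fract u, ⟨Int.fract_nonneg u, (Int.fract_lt_one u).le⟩,
    Int.fract v, ⟨Int.fract_nonneg v, (Int.fract_lt_one v).le⟩, ?_⟩
  have hu : (u : ℂ) = (⌊u⌋ : ℂ) + (Int.fract u : ℝ) := by
    exact_mod_cast (Int.floor_add_fract u).symm
  have hv : (v : ℂ) = (⌊v⌋ : ℂ) + (Int.fract v : ℝ) := by
    exact_mod_cast (Int.floor_add_fract v).symm
  rw [hu, hv]
  ring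

lemma const_of_doublyPeriodic {τ : ℂ} (hτ : 0 < τ.im) {E : ℂ → ℂ} (hE : Differentiable ℂ E)
    (h1 : ∀ z, E (z + 1) = E z) (h2 : ∀ z, E (z + τ) = E z) (z w : ℂ) : E z = E w := by
  refine hE.apply_eq_apply_of_bounded ?_ z w
  let K : Set ℂ := (fun x : ℝ × ℝ => (x.1 : ℂ) + x.2 * τ) '' (Set.Icc 0 1 ×ˢ Set.Icc 0 1)
  have hK : IsCompact K := (isCompact_Icc.prod isCompact_Icc).image (by fun_prop)
  refine (hK.image hE.continuous).isBounded.subset ?_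
  rintro _ ⟨z, rfl⟩
  obtain ⟨m, n, s, hs, t, ht, rfl⟩ := exists_mem_parallelogram hτ z
  refine ⟨_, ⟨(s, t), ⟨hs, ht⟩, rfl⟩, ?_⟩
  have p1 : Function.Periodic E 1 := h1
  have p2 : Function.Periodic E τ := h2
  rw [p2.int_mul n, p1.int_mul m]

/-- A function with only removable singularities which is additively quasi-periodic is affine. -/
lemma affine_of_quasiPeriodic {τ : ℂ} (hτ : 0 < τ.im) {f : ℂ → ℂ} {t : ℂ → ℂ}
    (hf : ∀ z, RemovableAt f z)
    (hper : ∀ l ∈ Lam τ, ∀ z, ∀ᶠ w in 𝓝[≠] z, f (w + l) = f w + t l) :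
    ∃ κ e : ℂ, (∀ z, ∀ᶠ w in 𝓝[≠] z, f w = κ * w + e) ∧ ∀ l ∈ Lam τ, κ * l = t l := by
  obtain ⟨E, hE, hfE⟩ := exists_entire_of_removableAt hf
  have hEper : ∀ l ∈ Lam τ, ∀ z, E (z + l) = E z + t l := by
    intro l hl z
    refine eq_of_punctured (f := fun z => E (z + l)) (g := fun z => E z + t l)
      (by have := hE.continuous; fun_prop) (by have := hE.continuous; fun_prop) ?_
    filter_upwards [(tendsto_add_right_punctured z l).eventually (hfE (z + l)), hfE z,
      hper l hl z] with w h1 h2 h3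
    rw [← h1, ← h2, h3]
  have hdper : ∀ l ∈ Lam τ, ∀ z, deriv E (z + l) = deriv E z := by
    intro l hl z
    rw [← deriv_comp_add_const]
    have : (fun x => E (x + l)) = fun x => E x + t l := funext (hEper l hl)
    rw [this, deriv_add_const]
  have hdE : Differentiable ℂ (deriv E) := fun z => (hE.analyticAt z).deriv.differentiableAt
  have hconst := const_of_doublyPeriodic hτ hdE (hdper 1 (one_mem_Lam τ))
    (hdper τ (tau_mem_Lam τ))
  have haff : ∀ z, E z = deriv E 0 * z + E 0 := by
    intro z
    have hd : Differentiable ℂ (fun z => E z - deriv E 0 * z) := by fun_prop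
    have := is_const_of_deriv_eq_zero hd (fun w => by
      have h := (hE w).hasDerivAt.sub ((hasDerivAt_id w).const_mul (deriv E 0))
      refine h.deriv.trans ?_
      rw [hconst w 0]; ring) z 0
    linear_combination this
  refine ⟨deriv E 0, E 0, fun z => ?_, fun l hl => ?_⟩
  · filter_upwards [hfE z] with w hw
    rw [hw, haff w]
  · have := hEper l hl 0
    rw [haff (0 + l), haff 0] at this
    linear_combination this

/-! ### Local analysis of the second symmetric product equation -/

/-- The second symmetric product equation at a point. -/
def SymSquareEq (q Φ : ℂ → ℂ) (z : ℂ) : Prop :=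
  deriv (deriv (deriv Φ)) z - 4 * q z * deriv Φ z - 2 * deriv q z * Φ z = 0

lemma eventuallyEq_deriv_punctured {f g : ℂ → ℂ} {z₀ : ℂ} (h : f =ᶠ[𝓝[≠] z₀] g) :
    deriv f =ᶠ[𝓝[≠] z₀] deriv g := by
  filter_upwards [h.eventually_nhds_of_punctured] with w hw
  exact hw.deriv_eq

lemma eventually_ne_punctured (z₀ : ℂ) : ∀ᶠ z in 𝓝[≠] z₀, z - z₀ ≠ 0 := by
  filter_upwards [self_mem_nhdsWithin] with z hz
  exact sub_ne_zero.2 hz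

lemma AnalyticAt.exists_eq_add_mul {f : ℂ → ℂ} {z₀ : ℂ} (hf : AnalyticAt ℂ f z₀) :
    ∃ h : ℂ → ℂ, AnalyticAt ℂ h z₀ ∧ ∀ z, f z = f z₀ + (z - z₀) * h z := by
  obtain ⟨p, hp⟩ := hf
  refine ⟨dslope f z₀, hp.has_fpower_series_dslope_fslope.analyticAt, fun z => ?_⟩
  have := sub_smul_dslope f z₀ z
  rw [smul_eq_mul] at this
  rw [this]; ring

/-- Differentiating `(z - z₀) ^ n * g z` away from `z₀`. -/
lemma deriv_zpow_mul_punctured {f g : ℂ → ℂ} {z₀ : ℂ} {n : ℤ} (hg : AnalyticAt ℂ g z₀)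
    (h : f =ᶠ[𝓝[≠] z₀] fun z => (z - z₀) ^ n * g z) :
    deriv f =ᶠ[𝓝[≠] z₀] fun z => (z - z₀) ^ (n - 1) * (n * g z + (z - z₀) * deriv g z) := by
  refine (eventuallyEq_deriv_punctured h).trans ?_
  filter_upwards [eventually_ne_punctured z₀, nhdsWithin_le_nhds hg.eventually_analyticAt]
    with z hz hgz
  have h1 := ((hasDerivAt_zpow n (z - z₀) (Or.inl hz)).comp_sub_const z z₀).mul
    hgz.differentiableAt.hasDerivAt
  refine h1.deriv.trans ?_
  rw [zpow_sub_one₀ hz]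
  field_simp

/-- Differentiating a function with two polar terms away from the pole. -/
lemma deriv_laurent_punctured {f F : ℂ → ℂ} {z₀ a b : ℂ} {m n : ℕ} (hF : AnalyticAt ℂ F z₀)
    (h : f =ᶠ[𝓝[≠] z₀] fun z => a / (z - z₀) ^ m + b / (z - z₀) ^ n + F z) :
    deriv f =ᶠ[𝓝[≠] z₀]
      fun z => (-m * a) / (z - z₀) ^ (m + 1) + (-n * b) / (z - z₀) ^ (n + 1) + deriv F z := by
  refine (eventuallyEq_deriv_punctured h).trans ?_
  filter_upwards [eventually_ne_punctured z₀, nhdsWithin_le_nhds hF.eventually_analyticAt]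
    with z hz hFz
  have hpow : ∀ (c : ℂ) (k : ℕ),
      HasDerivAt (fun z => c / (z - z₀) ^ k) ((-k * c) / (z - z₀) ^ (k + 1)) z := by
    intro c k
    have h1 := ((hasDerivAt_zpow (-(k : ℤ)) (z - z₀) (Or.inl hz)).comp_sub_const z z₀).const_mul c
    have h2 : (fun z => c / (z - z₀) ^ k) = fun z => c * (z - z₀) ^ (-(k : ℤ)) := by
      ext y; rw [zpow_neg, zpow_natCast, div_eq_mul_inv]
    rw [h2]
    refine h1.congr_deriv ?_
    rw [show -(k : ℤ) - 1 = -((k + 1 : ℕ) : ℤ) by push_cast; ring, zpow_neg, zpow_natCast]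
    push_cast
    ring
  exact (((hpow a m).add (hpow b n)).add hFz.differentiableAt.hasDerivAt).deriv

/-- The indicial equation. -/
lemma indicial_eq {q Φ r g : ℂ → ℂ} {z₀ : ℂ} {n : ℤ} (hr : AnalyticAt ℂ r z₀)
    (hg : AnalyticAt ℂ g z₀) (hgne : g z₀ ≠ 0)
    (hq : q =ᶠ[𝓝[≠] z₀] fun z => (z - z₀) ^ (-2 : ℤ) * r z)
    (hΦ : Φ =ᶠ[𝓝[≠] z₀] fun z => (z - z₀) ^ n * g z)
    (hode : ∀ᶠ z in 𝓝[≠] z₀, SymSquareEq q Φ z) :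
    (n : ℂ) * (n - 1) * (n - 2) - 4 * r z₀ * n + 4 * r z₀ = 0 := by
  let g1 : ℂ → ℂ := fun z => n * g z + (z - z₀) * deriv g z
  let g2 : ℂ → ℂ := fun z => ((n - 1 : ℤ) : ℂ) * g1 z + (z - z₀) * deriv g1 z
  let g3 : ℂ → ℂ := fun z => ((n - 1 - 1 : ℤ) : ℂ) * g2 z + (z - z₀) * deriv g2 z
  let r1 : ℂ → ℂ := fun z => ((-2 : ℤ) : ℂ) * r z + (z - z₀) * deriv r z
  have hg1 : AnalyticAt ℂ g1 z₀ := by have := hg.deriv; fun_prop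
  have hg2 : AnalyticAt ℂ g2 z₀ := by have := hg1.deriv; fun_prop
  have hg3 : AnalyticAt ℂ g3 z₀ := by have := hg2.deriv; fun_prop
  have hr1 : AnalyticAt ℂ r1 z₀ := by have := hr.deriv; fun_prop
  have d1 := deriv_zpow_mul_punctured hg hΦ
  have d2 := deriv_zpow_mul_punctured hg1 d1
  have d3 := deriv_zpow_mul_punctured hg2 d2
  have e1 := deriv_zpow_mul_punctured hr hq
  have hH : (fun z => g3 z - 4 * r z * g1 z - 2 * r1 z * g z) =ᶠ[𝓝[≠] z₀] fun _ => 0 := by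
    filter_upwards [hΦ, d1, d3, hq, e1, hode, eventually_ne_punctured z₀] with z a0 a1 a3 b0 b1 c hz
    unfold SymSquareEq at c
    rw [a0, a1, a3, b0, b1] at c
    have hne : (z - z₀) ^ (n - 3) ≠ 0 := zpow_ne_zero _ hz
    have z1 : (z - z₀) ^ (n - 1 - 1 - 1) = (z - z₀) ^ (n - 3) := by congr 1; ring
    have z2 : (z - z₀) ^ (-2 : ℤ) * (z - z₀) ^ (n - 1) = (z - z₀) ^ (n - 3) := by
      rw [← zpow_add₀ hz]; congr 1; ring
    have z3 : (z - z₀) ^ (-2 - 1 : ℤ) * (z - z₀) ^ n = (z - z₀) ^ (n - 3) := by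
      rw [← zpow_add₀ hz]; congr 1; ring
    refine (mul_eq_zero.1 ?_).resolve_left hne
    rw [z1] at c
    simp only [g3, g1, r1]
    linear_combination c + 4 * r z * (n * g z + (z - z₀) * deriv g z) * z2
      + 2 * (((-2 : ℤ) : ℂ) * r z + (z - z₀) * deriv r z) * g z * z3
  have h0 := eq_of_punctured (by fun_prop) continuousAt_const hH
  simp only [g3, g2, g1, r1, sub_self, zero_mul, add_zero] at h0
  push_cast at h0
  refine (mul_eq_zero.1 ?_).resolve_left hgne
  linear_combination h0

/-- Poles of meromorphic solutions are bounded by the exponents. -/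
lemma exists_pole_bound {q Φ r : ℂ → ℂ} {z₀ : ℂ} {m : ℕ} (hr : AnalyticAt ℂ r z₀)
    (hq : q =ᶠ[𝓝[≠] z₀] fun z => (z - z₀) ^ (-2 : ℤ) * r z)
    (hΦ : MeromorphicAt Φ z₀) (hode : ∀ᶠ z in 𝓝[≠] z₀, SymSquareEq q Φ z)
    (hroot : ∀ n : ℤ, (n : ℂ) * (n - 1) * (n - 2) - 4 * r z₀ * n + 4 * r z₀ = 0 → -(m : ℤ) ≤ n) :
    ∃ g : ℂ → ℂ, AnalyticAt ℂ g z₀ ∧ Φ =ᶠ[𝓝[≠] z₀] fun z => g z / (z - z₀) ^ m := by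
  by_cases htop : meromorphicOrderAt Φ z₀ = ⊤
  · rw [meromorphicOrderAt_eq_top_iff] at htop
    exact ⟨fun _ => 0, analyticAt_const, by filter_upwards [htop] with z hz; simp [hz]⟩
  · obtain ⟨n, hn⟩ := WithTop.ne_top_iff_exists.1 htop
    obtain ⟨g, hg, hgne, hΦg⟩ := (meromorphicOrderAt_eq_int_iff hΦ).1 hn.symm
    have hmn := hroot n (indicial_eq hr hg hgne hq hΦg hode)
    obtain ⟨k, hk⟩ := Int.eq_ofNat_of_zero_le (by lia : 0 ≤ n + m)
    refine ⟨fun z => (z - z₀) ^ k * g z, by fun_prop, ?_⟩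
    filter_upwards [hΦg, eventually_ne_punctured z₀] with z hz hne
    rw [hz, show n = (k : ℤ) - (m : ℤ) by lia, zpow_sub₀ hne, zpow_natCast, zpow_natCast,
      smul_eq_mul]
    ring

lemma exists_laurent_two {Φ g : ℂ → ℂ} {z₀ : ℂ} (hg : AnalyticAt ℂ g z₀)
    (h : Φ =ᶠ[𝓝[≠] z₀] fun z => g z / (z - z₀) ^ 2) :
    ∃ (c d : ℂ) (F : ℂ → ℂ), AnalyticAt ℂ F z₀ ∧
      Φ =ᶠ[𝓝[≠] z₀] fun z => c / (z - z₀) ^ 2 + d / (z - z₀) + F z := by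
  obtain ⟨g1, hg1, e1⟩ := hg.exists_eq_add_mul
  obtain ⟨g2, hg2, e2⟩ := hg1.exists_eq_add_mul
  refine ⟨g z₀, g1 z₀, g2, hg2, ?_⟩
  filter_upwards [h, eventually_ne_punctured z₀] with z hz hne
  rw [hz, e1, e2]
  field_simp
  ring

lemma exists_laurent_one {Φ g : ℂ → ℂ} {z₀ : ℂ} (hg : AnalyticAt ℂ g z₀)
    (h : Φ =ᶠ[𝓝[≠] z₀] fun z => g z / (z - z₀) ^ 1) :
    ∃ (d : ℂ) (F : ℂ → ℂ), AnalyticAt ℂ F z₀ ∧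
      Φ =ᶠ[𝓝[≠] z₀] fun z => d / (z - z₀) + F z := by
  obtain ⟨g1, hg1, e1⟩ := hg.exists_eq_add_mul
  refine ⟨g z₀, g1, hg1, ?_⟩
  filter_upwards [h, eventually_ne_punctured z₀] with z hz hne
  rw [hz, e1]
  field_simp

/-- At a double pole `2 / w²` of an otherwise regular potential, solutions have no `1 / w` term. -/
lemma residue_eq_zero {q Φ Q F : ℂ → ℂ} {z₀ c d : ℂ} (hQ : AnalyticAt ℂ Q z₀)
    (hF : AnalyticAt ℂ F z₀) (hq : q =ᶠ[𝓝[≠] z₀] fun z => 2 / (z - z₀) ^ 2 + Q z)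
    (hΦ : Φ =ᶠ[𝓝[≠] z₀] fun z => c / (z - z₀) ^ 2 + d / (z - z₀) + F z)
    (hode : ∀ᶠ z in 𝓝[≠] z₀, SymSquareEq q Φ z) : d = 0 := by
  have hΦ' : Φ =ᶠ[𝓝[≠] z₀] fun z => c / (z - z₀) ^ 2 + d / (z - z₀) ^ 1 + F z := by
    simpa only [pow_one] using hΦ
  have hq' : q =ᶠ[𝓝[≠] z₀] fun z => 2 / (z - z₀) ^ 2 + 0 / (z - z₀) ^ 1 + Q z := by
    simpa only [zero_div, add_zero] using hq
  have d1 := deriv_laurent_punctured hF hΦ'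
  have d2 := deriv_laurent_punctured hF.deriv d1
  have d3 := deriv_laurent_punctured hF.deriv.deriv d2
  have e1 := deriv_laurent_punctured hQ hq'
  have a1 := hF.deriv
  have a3 := hF.deriv.deriv.deriv
  have b1 := hQ.deriv
  have hH : (fun z => 10 * d + (z - z₀) * (8 * c * Q z - 2 * c * (z - z₀) * deriv Q z + 8 * F z
      + 4 * d * (z - z₀) * Q z - 2 * d * (z - z₀) ^ 2 * deriv Q z
      - 8 * (z - z₀) * deriv F z + (z - z₀) ^ 3 * (deriv (deriv (deriv F)) z
        - 4 * Q z * deriv F z - 2 * deriv Q z * F z))) =ᶠ[𝓝[≠] z₀] fun _ => 0 := by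
    filter_upwards [hΦ', d1, d3, hq', e1, hode, eventually_ne_punctured z₀]
      with z x0 x1 x3 y0 y1 h hne
    unfold SymSquareEq at h
    rw [x0, x1, x3, y0, y1] at h
    push_cast at h
    field_simp at h
    refine (mul_eq_zero.1 ?_).resolve_left hne
    linear_combination h
  have h0 := eq_of_punctured (by fun_prop) continuousAt_const hH
  simp only [sub_self, zero_mul, add_zero] at h0
  simpa using h0

lemma deriv_of_eq_add_mul {f h : ℂ → ℂ} {z₀ c : ℂ} (hh : AnalyticAt ℂ h z₀)
    (e : ∀ z, f z = c + (z - z₀) * h z) :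
    deriv f z₀ = h z₀ ∧ deriv (deriv f) z₀ = 2 * deriv h z₀ := by
  have hf : f = fun z => c + (z - z₀) * h z := funext e
  have h1 : deriv f =ᶠ[𝓝 z₀] fun z => h z + (z - z₀) * deriv h z := by
    filter_upwards [hh.eventually_analyticAt] with z hz
    have := (((hasDerivAt_id z).sub_const z₀).mul hz.differentiableAt.hasDerivAt).const_add c
    rw [hf]
    refine this.deriv.trans ?_
    simp
  have h2 := hh.differentiableAt.hasDerivAt.add
    (((hasDerivAt_id z₀).sub_const z₀).mul hh.deriv.differentiableAt.hasDerivAt)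
  refine ⟨by simpa using h1.eq_of_nhds, h1.deriv_eq.trans (h2.deriv.trans ?_)⟩
  simp
  ring

lemma eq_zero_of_add_mul_eq_zero {K : ℂ → ℂ} {z₀ a : ℂ} (hK : AnalyticAt ℂ K z₀)
    (h : (fun z => a + (z - z₀) * K z) =ᶠ[𝓝[≠] z₀] fun _ => 0) :
    a = 0 ∧ K =ᶠ[𝓝[≠] z₀] fun _ => 0 := by
  have ha : a = 0 := by
    simpa using eq_of_punctured (by have := hK; fun_prop) continuousAt_const h
  refine ⟨ha, ?_⟩
  filter_upwards [h, eventually_ne_punctured z₀] with z hz hne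
  rw [ha, zero_add] at hz
  exact (mul_eq_zero.1 hz).resolve_left hne

lemma coefficients_eq_zero {T0 T1 T2 T3 : ℂ → ℂ} {z₀ : ℂ} (h0 : AnalyticAt ℂ T0 z₀)
    (h1 : AnalyticAt ℂ T1 z₀) (h2 : AnalyticAt ℂ T2 z₀) (h3 : AnalyticAt ℂ T3 z₀)
    (h : (fun z => T0 z + (z - z₀) * T1 z + (z - z₀) ^ 2 * T2 z + (z - z₀) ^ 3 * T3 z)
      =ᶠ[𝓝[≠] z₀] fun _ => 0) :
    T0 z₀ = 0 ∧ deriv (deriv T0) z₀ + 2 * deriv T1 z₀ + 2 * T2 z₀ = 0 := by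
  obtain ⟨u, hu, eu⟩ := h0.exists_eq_add_mul
  obtain ⟨v, hv, ev⟩ := hu.exists_eq_add_mul
  obtain ⟨x, hx, ex⟩ := h1.exists_eq_add_mul
  rw [(deriv_of_eq_add_mul hu eu).2, (deriv_of_eq_add_mul hv ev).1, (deriv_of_eq_add_mul hx ex).1]
  have k1 := eq_zero_of_add_mul_eq_zero (z₀ := z₀) (a := T0 z₀)
    (K := fun z => (u z₀ + T1 z₀) + (z - z₀) * (v z + x z + T2 z + (z - z₀) * T3 z))
    (by fun_prop) ?_
  · obtain ⟨k1, k2⟩ := k1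
    obtain ⟨-, k3⟩ := eq_zero_of_add_mul_eq_zero (by fun_prop) k2
    have k4 := eq_of_punctured (by fun_prop) continuousAt_const k3
    simp only [sub_self, zero_mul, add_zero] at k4
    exact ⟨k1, by linear_combination 2 * k4⟩
  · filter_upwards [h] with z hz
    rw [eu z, ev z, ex z] at hz
    linear_combination hz

/-- The Frobenius relations at a pole of the potential with leading coefficient `3/4`. -/
lemma frobenius_relations {q Φ Q F : ℂ → ℂ} {z₀ a A : ℂ} (hQ : AnalyticAt ℂ Q z₀)
    (hF : AnalyticAt ℂ F z₀)
    (hq : q =ᶠ[𝓝[≠] z₀] fun z => (3 / 4) / (z - z₀) ^ 2 + A / (z - z₀) + Q z)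
    (hΦ : Φ =ᶠ[𝓝[≠] z₀] fun z => a / (z - z₀) + F z)
    (hode : ∀ᶠ z in 𝓝[≠] z₀, SymSquareEq q Φ z) :
    F z₀ = -2 * A * a ∧
      -3 * deriv (deriv F) z₀ - 4 * A * deriv F z₀ + 4 * a * deriv Q z₀ = 0 := by
  have hΦ' : Φ =ᶠ[𝓝[≠] z₀] fun z => 0 / (z - z₀) ^ 2 + a / (z - z₀) ^ 1 + F z := by
    simpa only [pow_one, zero_div, zero_add] using hΦ
  have hq' : q =ᶠ[𝓝[≠] z₀] fun z => (3 / 4) / (z - z₀) ^ 2 + A / (z - z₀) ^ 1 + Q z := by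
    simpa only [pow_one] using hq
  have d1 := deriv_laurent_punctured hF hΦ'
  have d2 := deriv_laurent_punctured hF.deriv d1
  have d3 := deriv_laurent_punctured hF.deriv.deriv d2
  have e1 := deriv_laurent_punctured hQ hq'
  have a1 := hF.deriv
  have a3 := hF.deriv.deriv.deriv
  have b1 := hQ.deriv
  obtain ⟨T0, hT0⟩ : ∃ T : ℂ → ℂ, T = fun z => 6 * A * a + 3 * F z := ⟨_, rfl⟩
  obtain ⟨T1, hT1⟩ : ∃ T : ℂ → ℂ, T = fun z => -3 * deriv F z + 4 * a * Q z + 2 * A * F z :=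
    ⟨_, rfl⟩
  obtain ⟨T2, hT2⟩ : ∃ T : ℂ → ℂ, T = fun z => -4 * A * deriv F z - 2 * a * deriv Q z :=
    ⟨_, rfl⟩
  obtain ⟨T3, hT3⟩ : ∃ T : ℂ → ℂ, T = fun z => deriv (deriv (deriv F)) z - 4 * Q z * deriv F z
    - 2 * deriv Q z * F z := ⟨_, rfl⟩
  have hT0a : AnalyticAt ℂ T0 z₀ := by rw [hT0]; fun_prop
  have hT1a : AnalyticAt ℂ T1 z₀ := by rw [hT1]; fun_prop
  have hT2a : AnalyticAt ℂ T2 z₀ := by rw [hT2]; fun_prop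
  have hT3a : AnalyticAt ℂ T3 z₀ := by rw [hT3]; fun_prop
  have hH : (fun z => T0 z + (z - z₀) * T1 z + (z - z₀) ^ 2 * T2 z + (z - z₀) ^ 3 * T3 z)
      =ᶠ[𝓝[≠] z₀] fun _ => 0 := by
    filter_upwards [hΦ', d1, d3, hq', e1, hode, eventually_ne_punctured z₀]
      with z x0 x1 x3 y0 y1 h hne
    unfold SymSquareEq at h
    rw [x0, x1, x3, y0, y1] at h
    push_cast at h
    field_simp at h
    rw [hT0, hT1, hT2, hT3]
    refine (mul_eq_zero.1 ?_).resolve_left (pow_ne_zero 2 hne)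
    linear_combination h / 4
  obtain ⟨h0, h2⟩ := coefficients_eq_zero hT0a hT1a hT2a hT3a hH
  have dT0 : deriv (deriv T0) z₀ = 3 * deriv (deriv F) z₀ := by
    have e : deriv T0 = fun z => 3 * deriv F z := by
      ext z; rw [hT0, deriv_const_add, deriv_const_mul_field]
    rw [e, deriv_const_mul_field]
  have dT1 : deriv T1 z₀ = -3 * deriv (deriv F) z₀ + 4 * a * deriv Q z₀ + 2 * A * deriv F z₀ := by
    have f1 := a1.differentiableAt.hasDerivAt.const_mul (-3)
    have f2 := hQ.differentiableAt.hasDerivAt.const_mul (4 * a)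
    have f3 := hF.differentiableAt.hasDerivAt.const_mul (2 * A)
    rw [hT1]
    exact ((f1.add f2).add f3).deriv
  rw [dT0, dT1, hT2] at h2
  rw [hT0] at h0
  constructor
  · linear_combination h0 / 3
  · linear_combination h2

/-! ### Elliptic functions with a prescribed pole -/

lemma AnalyticAt.comp_add_right {f : ℂ → ℂ} {z c : ℂ} (hf : AnalyticAt ℂ f (z + c)) :
    AnalyticAt ℂ (fun w => f (w + c)) z :=
  AnalyticAt.fun_comp hf (analyticAt_id.add analyticAt_const)

lemma AnalyticAt.comp_sub_right {f : ℂ → ℂ} {z c : ℂ} (hf : AnalyticAt ℂ f (z - c)) :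
    AnalyticAt ℂ (fun w => f (w - c)) z :=
  AnalyticAt.fun_comp hf (analyticAt_id.sub analyticAt_const)

lemma eventually_add_notMem_Lam {τ : ℂ} (hτ : 0 < τ.im) (z c : ℂ) :
    ∀ᶠ w in 𝓝[≠] z, w + c ∉ Lam τ :=
  (tendsto_add_right_punctured z c).eventually (eventually_notMem_Lam hτ _)

lemma eventually_sub_notMem_Lam {τ : ℂ} (hτ : 0 < τ.im) (z c : ℂ) :
    ∀ᶠ w in 𝓝[≠] z, w - c ∉ Lam τ := by
  simpa only [sub_eq_add_neg] using eventually_add_notMem_Lam hτ z (-c)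

/-- `℘` is not locally constant. -/
lemma not_eventuallyEq_const_wp {τ z₀ : ℂ} (hτ : 0 < τ.im) (hz₀ : z₀ ∉ Lam τ) (c : ℂ) :
    ¬ wp τ =ᶠ[𝓝[≠] z₀] fun _ => c := by
  intro h
  have han : AnalyticOnNhd ℂ (wp τ) (Lam τ)ᶜ := fun z hz => analyticAt_wp hτ hz
  have h' := ((analyticAt_wp hτ hz₀).continuousAt.eventuallyEq_nhds_iff_eventuallyEq_nhdsNE
    continuousAt_const).1 h
  have heq := han.eqOn_of_preconnected_of_eventuallyEq (fun _ _ => analyticAt_const)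
    (isPreconnected_compl_Lam τ) hz₀ h'
  have h0 : (fun _ : ℂ => (1 : ℂ)) =ᶠ[𝓝[≠] 0] fun z => z ^ 2 * (c - wpReg τ z) := by
    filter_upwards [eventually_notMem_Lam hτ 0, self_mem_nhdsWithin] with z hz hne
    have hne' : z ≠ 0 := hne
    have e : wp τ z = c := heq hz
    rw [← e, wp_eq]
    field_simp
    ring
  have hR := analyticAt_wpReg hτ (zero_notMem_Lam' τ)
  have := eq_of_punctured continuousAt_const
    (AnalyticAt.continuousAt (𝕜 := ℂ) (by fun_prop)) h0
  simp at this

lemma notMem_Lam_of_two_mul {τ p : ℂ} (hp : 2 * p ∉ Lam τ) : p ∉ Lam τ := fun h =>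
  hp (by rw [two_mul]; exact add_mem_Lam h h)

/-- The duplication formula for `ζ`, together with `℘'(p) ≠ 0` away from the half periods. -/
lemma wzeta_two_mul {τ p : ℂ} (hτ : 0 < τ.im) (hp : 2 * p ∉ Lam τ) :
    wpd τ p ≠ 0 ∧ wzeta τ (2 * p) = 2 * wzeta τ p + wpdd τ p / (2 * wpd τ p) := by
  have hp1 := notMem_Lam_of_two_mul hp
  have hnp : -p ∉ Lam τ := fun h => hp1 (neg_mem_Lam_iff.1 h)
  set f : ℂ → ℂ := fun z => wzeta τ (z + p) - wzeta τ (z - p) - 2 * wzeta τ p with hf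
  set G : ℂ → ℂ := fun z => f z * (wp τ z - wp τ p) with hG
  have hper : ∀ l ∈ Lam τ, ∀ z, ∀ᶠ w in 𝓝[≠] z, G (w + l) = G w + 0 := by
    intro l hl z
    obtain ⟨c, hc⟩ := exists_quasiPeriod_wzeta hτ hl
    filter_upwards [eventually_add_notMem_Lam hτ z p, eventually_sub_notMem_Lam hτ z p] with w h1 h2
    have e1 : w + l + p = w + p + l := by ring
    have e2 : w + l - p = w - p + l := by ring
    simp only [hG, hf, wp_add hτ hl, e1, e2, hc _ h1, hc _ h2]
    ring
  obtain ⟨k, hk, ek⟩ := (analyticAt_wp hτ hp1).exists_eq_add_mul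
  have h2p : p + p ∉ Lam τ := by rwa [← two_mul]
  have hM : AnalyticAt ℂ (fun z => wzeta τ (z + p) - wzetaReg τ (z - p) - 2 * wzeta τ p) p := by
    have h1 := (analyticAt_wzeta hτ h2p).comp_add_right
    have h2 : AnalyticAt ℂ (fun z => wzetaReg τ (z - p)) p :=
      AnalyticAt.comp_sub_right (by rw [sub_self]; exact analyticAt_wzetaReg hτ (zero_notMem_Lam' τ))
    fun_prop
  set M : ℂ → ℂ := fun z => wzeta τ (z + p) - wzetaReg τ (z - p) - 2 * wzeta τ p with hMdef
  have hGp : G =ᶠ[𝓝[≠] p] fun z => -k z + (z - p) * (M z * k z) := by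
    filter_upwards [eventually_ne_punctured p] with z hz
    simp only [hG, hf, hMdef, ek z, wzeta_eq τ (z - p)]
    field_simp
    ring
  have r0 : RemovableAt G 0 := by
    have hfa : AnalyticAt ℂ f 0 := by
      have h1 := AnalyticAt.comp_add_right (z := 0) (c := p)
        (by rw [zero_add]; exact analyticAt_wzeta hτ hp1)
      have h2 := AnalyticAt.comp_sub_right (z := 0) (c := p)
        (by rw [zero_sub]; exact analyticAt_wzeta hτ hnp)
      fun_prop
    obtain ⟨h, hh, eh⟩ := hfa.exists_eq_add_mul
    obtain ⟨h2, hh2, eh2⟩ := hh.exists_eq_add_mul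
    have f0 : f 0 = 0 := by
      simp only [hf, zero_add, zero_sub, wzeta_neg]; ring
    have f1 : h 0 = 0 := by
      rw [← (deriv_of_eq_add_mul hh eh).1]
      have d1 : HasDerivAt (wzeta τ) (-wp τ p) (0 + p) := by
        rw [zero_add]; exact hasDerivAt_wzeta hτ hp1
      have d2 : HasDerivAt (wzeta τ) (-wp τ p) (0 - p) := by
        rw [zero_sub, ← wp_neg hτ p]; exact hasDerivAt_wzeta hτ hnp
      have d3 := ((d1.comp_add_const 0 p).sub (d2.comp_sub_const 0 p)).sub_const (2 * wzeta τ p)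
      refine d3.deriv.trans (by ring)
    have hR := analyticAt_wpReg hτ (zero_notMem_Lam' τ)
    refine ⟨fun z => h2 z * (1 + z ^ 2 * (wpReg τ z - wp τ p)), by fun_prop, ?_⟩
    filter_upwards [self_mem_nhdsWithin] with z hz
    have hz' : z ≠ 0 := hz
    simp only [hG]
    rw [eh z, eh2 z, f0, f1, wp_eq τ z]
    field_simp
    ring
  have rp : RemovableAt G p := ⟨_, by fun_prop, hGp⟩
  have rn : RemovableAt G (-p) := by
    obtain ⟨k', hk', ek'⟩ := (analyticAt_wp hτ hnp).exists_eq_add_mul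
    have h1 : AnalyticAt ℂ (fun z => wzeta τ (z - p)) (-p) := by
      refine AnalyticAt.comp_sub_right (analyticAt_wzeta hτ ?_)
      rw [← neg_mem_Lam_iff]
      convert hp using 2; ring
    have h2 : AnalyticAt ℂ (fun z => wzetaReg τ (z + p)) (-p) :=
      AnalyticAt.comp_add_right
        (by rw [neg_add_cancel]; exact analyticAt_wzetaReg hτ (zero_notMem_Lam' τ))
    refine ⟨fun z => k' z + (z + p) * ((wzetaReg τ (z + p) - wzeta τ (z - p) - 2 * wzeta τ p)
      * k' z), by fun_prop, ?_⟩
    filter_upwards [eventually_ne_punctured (-p)] with z hz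
    rw [sub_neg_eq_add] at hz
    simp only [hG, hf, ek' z, wp_neg hτ, wzeta_eq τ (z + p)]
    field_simp
    ring
  have hrem : ∀ z, RemovableAt G z := by
    intro z
    by_cases c0 : z ∈ Lam τ
    · simpa using r0.translate (hper z c0 0)
    by_cases c1 : z - p ∈ Lam τ
    · simpa using rp.translate (hper _ c1 p)
    by_cases c2 : z + p ∈ Lam τ
    · simpa using rn.translate (hper _ c2 (-p))
    have h1 := (analyticAt_wzeta hτ c2).comp_add_right
    have h2 := (analyticAt_wzeta hτ c1).comp_sub_right
    have h3 := analyticAt_wp hτ c0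
    refine AnalyticAt.removableAt ?_
    fun_prop
  obtain ⟨κ, e, he, hκ⟩ := affine_of_quasiPeriodic hτ hrem hper
  have hκ0 : κ = 0 := by simpa using hκ 1 (one_mem_Lam τ)
  obtain ⟨k2, hk2, ek2⟩ := hk.exists_eq_add_mul
  have hke : (fun z => (-k p - e) + (z - p) * (M z * k z - k2 z)) =ᶠ[𝓝[≠] p] fun _ => 0 := by
    filter_upwards [hGp, he p] with z h1 h2
    rw [h1, hκ0] at h2
    have := ek2 z
    linear_combination h2 + this
  obtain ⟨i1, i2⟩ := eq_zero_of_add_mul_eq_zero (by fun_prop) hke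
  have i3 := eq_of_punctured (AnalyticAt.continuousAt (𝕜 := ℂ) (by fun_prop)) continuousAt_const i2
  have dk : wpd τ p = k p := (deriv_of_eq_add_mul hk ek).1
  have ddk : wpdd τ p = 2 * k2 p := by
    rw [← (deriv_of_eq_add_mul hk2 ek2).1]; exact (deriv_of_eq_add_mul hk ek).2
  have hne : wpd τ p ≠ 0 := by
    rw [dk]
    intro hk0
    refine not_eventuallyEq_const_wp hτ hp1 (wp τ p) ?_
    have hcont : ∀ᶠ z in 𝓝[≠] p, -1 + (z - p) * M z ≠ 0 := by
      refine nhdsWithin_le_nhds (ContinuousAt.eventually_ne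
        (g := fun z => -1 + (z - p) * M z) (AnalyticAt.continuousAt (𝕜 := ℂ) (by fun_prop)) (by simp))
    filter_upwards [hGp, he p, hcont] with z h1 h2 h3
    rw [h1, hκ0] at h2
    have e0 : e = 0 := by linear_combination -i1 - hk0
    have : (-1 + (z - p) * M z) * k z = 0 := by linear_combination h2 + e0
    rw [ek z, (mul_eq_zero.1 this).resolve_left h3, mul_zero, add_zero]
  refine ⟨hne, ?_⟩
  have hMp : M p = wzeta τ (2 * p) - 2 * wzeta τ p := by
    simp [hMdef, wzetaReg_zero, two_mul]
  rw [dk] at hne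
  rw [dk, ddk]
  rw [hMp] at i3
  field_simp
  linear_combination i3

/-! ### The quasi-periods of `ζ` are not proportional to the periods -/

lemma wpd_add {τ l : ℂ} (hτ : 0 < τ.im) (hl : l ∈ Lam τ) (z : ℂ) :
    wpd τ (z + l) = wpd τ z := by
  rw [wpd, ← deriv_comp_add_const]
  congr 1
  exact funext (wp_add hτ hl)

lemma wpd_neg {τ : ℂ} (hτ : 0 < τ.im) (z : ℂ) : wpd τ (-z) = -wpd τ z := by
  have h := deriv_comp_neg (wp τ) z
  have e : (fun x => wp τ (-x)) = wp τ := funext (wp_neg hτ)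
  rw [e] at h
  rw [wpd, h, neg_neg]

lemma hasDerivAt_wp {τ z : ℂ} (hτ : 0 < τ.im) (hz : z ∉ Lam τ) :
    HasDerivAt (wp τ) (wpd τ z) z :=
  (analyticAt_wp hτ hz).differentiableAt.hasDerivAt

lemma analyticAt_wpd {τ z : ℂ} (hτ : 0 < τ.im) (hz : z ∉ Lam τ) : AnalyticAt ℂ (wpd τ) z :=
  (analyticAt_wp hτ hz).deriv

/-- A solution of `v' = f v` which is not locally zero has no zeros. -/
lemma ne_zero_of_deriv_eq_mul {v f : ℂ → ℂ} {z₀ : ℂ} (hv : AnalyticAt ℂ v z₀)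
    (hf : AnalyticAt ℂ f z₀) (h : ∀ᶠ z in 𝓝[≠] z₀, deriv v z = f z * v z)
    (hne : ¬ v =ᶠ[𝓝 z₀] fun _ => 0) : v z₀ ≠ 0 := by
  obtain ⟨n, g, hg, hg0, hvg⟩ := hv.exists_eventuallyEq_pow_smul_nonzero_iff.2 hne
  have hvg' : v =ᶠ[𝓝[≠] z₀] fun z => (z - z₀) ^ (n : ℤ) * g z := by
    filter_upwards [nhdsWithin_le_nhds hvg] with z hz
    rw [hz, zpow_natCast, smul_eq_mul]
  have hd := deriv_zpow_mul_punctured hg hvg'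
  have hg' := hg.deriv
  have key : (fun z => (n : ℂ) * g z + (z - z₀) * (deriv g z - f z * g z)) =ᶠ[𝓝[≠] z₀]
      fun _ => 0 := by
    filter_upwards [hd, h, hvg', eventually_ne_punctured z₀] with z h1 h2 h3 hz
    rw [h2, h3, zpow_sub_one₀ hz] at h1
    have hzn : (z - z₀) ^ (n : ℤ) ≠ 0 := zpow_ne_zero _ hz
    push_cast at h1
    field_simp at h1
    linear_combination -h1
  have := eq_of_punctured (AnalyticAt.continuousAt (𝕜 := ℂ) (by fun_prop)) continuousAt_const key
  simp only [sub_self, zero_mul, add_zero, mul_eq_zero, hg0, or_false] at this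
  have hn : n = 0 := by exact_mod_cast this
  rw [hvg.self_of_nhds, hn]
  simpa using hg0

lemma not_quasiPeriod_proportional {τ α : ℂ} (hτ : 0 < τ.im) :
    ¬ ∀ l ∈ Lam τ, ∀ z ∉ Lam τ, wzeta τ (z + l) = wzeta τ z + α * l := by
  intro hα
  set f : ℂ → ℂ := fun z => wzeta τ z - α * z with hf
  set H : ℂ → ℂ := fun z => wpd τ z + 2 * f z * (wp τ z + α) with hH
  have hR := analyticAt_wpReg hτ (zero_notMem_Lam' τ)
  have hper : ∀ l ∈ Lam τ, ∀ z, ∀ᶠ w in 𝓝[≠] z, H (w + l) = H w + 0 := by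
    intro l hl z
    filter_upwards [eventually_notMem_Lam hτ z] with w hw
    simp only [hH, hf, wpd_add hτ hl, wp_add hτ hl, hα l hl w hw]
    ring
  have hHan : ∀ z ∉ Lam τ, AnalyticAt ℂ H z := by
    intro z hz
    have h1 := analyticAt_wp hτ hz
    have h2 := analyticAt_wpd hτ hz
    have h3 := analyticAt_wzeta hτ hz
    fun_prop
  have r0 : RemovableAt H 0 := by
    have hη := analyticAt_wzetaReg hτ (zero_notMem_Lam' τ)
    obtain ⟨η1, hη1, eη1⟩ := hη.exists_eq_add_mul
    obtain ⟨η2, hη2, eη2⟩ := hη1.exists_eq_add_mul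
    obtain ⟨R1, hR1, eR1⟩ := hR.exists_eq_add_mul
    have η0 : η1 0 = 0 := by
      rw [← (deriv_of_eq_add_mul hη1 eη1).1, deriv_wzetaReg hτ (zero_notMem_Lam' τ),
        wpReg_zero hτ, neg_zero]
    have hRd := hR.deriv
    refine ⟨fun z => deriv (wpReg τ) z + 2 * R1 z + 2 * η2 z
      + 2 * (wzetaReg τ z - α * z) * (wpReg τ z + α), by fun_prop, ?_⟩
    have hwp : wp τ =ᶠ[𝓝[≠] 0] fun z => 1 / (z - 0) ^ 2 + 0 / (z - 0) ^ 0 + wpReg τ z :=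
      .of_forall fun z => by simp [wp_eq]
    filter_upwards [self_mem_nhdsWithin, deriv_laurent_punctured hR hwp] with z hz hd
    have hz' : z ≠ 0 := hz
    have hη' : wzetaReg τ z = z ^ 2 * η2 z := by
      rw [eη1 z, eη2 z, η0, wzetaReg_zero]; ring
    have hR' : wpReg τ z = z * R1 z := by
      rw [eR1 z, wpReg_zero hτ]; ring
    simp only [hH, hf, wpd, hd, wp_eq, wzeta_eq, hη', hR', sub_zero]
    push_cast
    field_simp
    ring
  have hrem : ∀ z, RemovableAt H z := by
    intro z
    by_cases c0 : z ∈ Lam τ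
    · simpa using r0.translate (hper z c0 0)
    · exact (hHan z c0).removableAt
  obtain ⟨κ, e, he, hκ⟩ := affine_of_quasiPeriodic hτ hrem hper
  have hκ0 : κ = 0 := by simpa using hκ 1 (one_mem_Lam τ)
  have hHe : ∀ z ∉ Lam τ, H z = e := fun z hz =>
    eq_of_punctured (g := fun _ => e) (hHan z hz).continuousAt continuousAt_const (by
      filter_upwards [he z] with w hw
      rw [hw, hκ0]; ring)
  have hodd : ∀ z, H (-z) = -H z := by
    intro z
    simp only [hH, hf, wpd_neg hτ, wp_neg hτ, wzeta_neg]
    ring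
  obtain ⟨z₁, hz₁⟩ := (eventually_notMem_Lam hτ 0).exists
  have he0 : e = 0 := by
    have h1 := hHe _ hz₁
    have h2 := hHe (-z₁) (fun h => hz₁ (neg_mem_Lam_iff.1 h))
    rw [hodd, h1] at h2
    linear_combination -h2 / 2
  have hv : ∀ z ∉ Lam τ, wp τ z + α ≠ 0 := by
    intro z hz
    have h1 := analyticAt_wp hτ hz
    have h3 := analyticAt_wzeta hτ hz
    refine ne_zero_of_deriv_eq_mul (v := fun z => wp τ z + α) (f := fun z => -2 * f z)
      (by fun_prop) (by fun_prop) ?_ ?_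
    · filter_upwards [eventually_notMem_Lam hτ z] with w hw
      rw [deriv_add_const]
      have := hHe w hw
      simp only [hH, wpd] at this
      linear_combination this + he0
    · intro h
      refine not_eventuallyEq_const_wp hτ hz (-α) ?_
      filter_upwards [nhdsWithin_le_nhds h] with w hw
      linear_combination hw
  set u : ℂ → ℂ := fun z => 1 / (wp τ z + α) with hu
  have hperu : ∀ l ∈ Lam τ, ∀ z, ∀ᶠ w in 𝓝[≠] z, u (w + l) = u w + 0 := fun l hl z =>
    .of_forall fun w => by simp only [hu, wp_add hτ hl, add_zero]
  have han : AnalyticAt ℂ (fun z => z ^ 2 / (1 + z ^ 2 * (wpReg τ z + α))) 0 := by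
    refine AnalyticAt.div (by fun_prop) (by fun_prop) (by simp)
  have hu0 : u =ᶠ[𝓝[≠] 0] fun z => z ^ 2 / (1 + z ^ 2 * (wpReg τ z + α)) := by
    filter_upwards [self_mem_nhdsWithin] with z hz
    have hz' : z ≠ 0 := hz
    have : wp τ z + α = (1 + z ^ 2 * (wpReg τ z + α)) / z ^ 2 := by
      rw [wp_eq]; field_simp; ring
    simp only [hu, this, one_div_div]
  have hremu : ∀ z, RemovableAt u z := by
    intro z
    by_cases c0 : z ∈ Lam τ
    · simpa using RemovableAt.translate ⟨_, han, hu0⟩ (hperu z c0 0)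
    · have h1 := analyticAt_wp hτ c0
      exact AnalyticAt.removableAt (analyticAt_const.div (by fun_prop) (hv z c0))
  obtain ⟨κ', e', he', hκ'⟩ := affine_of_quasiPeriodic hτ hremu hperu
  have hκ0' : κ' = 0 := by simpa using hκ' 1 (one_mem_Lam τ)
  have hzero : (0 : ℂ) = e' := by
    have := eq_of_punctured (g := fun _ => e') han.continuousAt continuousAt_const (by
      filter_upwards [hu0, he' 0] with w h1 h2
      rw [← h1, h2, hκ0']; ring)
    simpa using this
  obtain ⟨z₂, hz₂, h₂⟩ := ((eventually_notMem_Lam hτ 0).and (he' 0)).exists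
  rw [hκ0', ← hzero, zero_mul, zero_add] at h₂
  exact one_div_ne_zero (hv z₂ hz₂) h₂

/-! ### Local structure of the potential and of the solutions -/

lemma MeromorphicAt.removableAt_of_symSquareEq {q Φ : ℂ → ℂ} {z₀ : ℂ} (hΦ : MeromorphicAt Φ z₀)
    (hq : AnalyticAt ℂ q z₀) (hode : ∀ᶠ z in 𝓝[≠] z₀, SymSquareEq q Φ z) : RemovableAt Φ z₀ := by
  obtain ⟨g, hg, h⟩ := exists_pole_bound (m := 0) (r := fun z => (z - z₀) ^ 2 * q z) (by fun_prop)
    (by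
      filter_upwards [eventually_ne_punctured z₀] with z hz
      field_simp) hΦ hode (by
      intro n hn
      simp only [sub_self, ne_eq, OfNat.ofNat_ne_zero, not_false_eq_true, zero_pow, zero_mul,
        mul_zero, sub_zero, add_zero] at hn
      have hn' : n * (n - 1) * (n - 2) = 0 := by exact_mod_cast hn
      simp only [mul_eq_zero] at hn'
      lia)
  exact ⟨g, hg, by simpa using h⟩

lemma exists_simple_pole_of_symSquareEq {q Φ Q : ℂ → ℂ} {z₀ A : ℂ} (hΦ : MeromorphicAt Φ z₀)
    (hQ : AnalyticAt ℂ Q z₀) (hq : ∀ z, q z = (3 / 4) / (z - z₀) ^ 2 + A / (z - z₀) + Q z)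
    (hode : ∀ᶠ z in 𝓝[≠] z₀, SymSquareEq q Φ z) :
    ∃ (a : ℂ) (F : ℂ → ℂ), AnalyticAt ℂ F z₀ ∧ Φ =ᶠ[𝓝[≠] z₀] fun z => a / (z - z₀) + F z := by
  obtain ⟨g, hg, h⟩ := exists_pole_bound (m := 1)
    (r := fun z => 3 / 4 + (z - z₀) * A + (z - z₀) ^ 2 * Q z) (by fun_prop)
    (by
      filter_upwards [eventually_ne_punctured z₀] with z hz
      rw [hq]
      field_simp) hΦ hode (by
      intro n hn
      simp only [sub_self, ne_eq, OfNat.ofNat_ne_zero, not_false_eq_true, zero_pow, zero_mul,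
        add_zero] at hn
      have hn2 : (n - 1) * (n - 3) * (n + 1) = 0 := by
        have : ((n : ℂ) - 1) * (n - 3) * (n + 1) = 0 := by linear_combination hn
        exact_mod_cast this
      simp only [mul_eq_zero] at hn2
      lia)
  exact exists_laurent_one hg h

lemma exists_double_pole_of_symSquareEq {q Φ Q : ℂ → ℂ} {z₀ : ℂ} (hΦ : MeromorphicAt Φ z₀)
    (hQ : AnalyticAt ℂ Q z₀) (hq : ∀ z, q z = 2 / (z - z₀) ^ 2 + Q z)
    (hode : ∀ᶠ z in 𝓝[≠] z₀, SymSquareEq q Φ z) :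
    ∃ (c : ℂ) (F : ℂ → ℂ), AnalyticAt ℂ F z₀ ∧
      Φ =ᶠ[𝓝[≠] z₀] fun z => c / (z - z₀) ^ 2 + F z := by
  obtain ⟨g, hg, h⟩ := exists_pole_bound (m := 2)
    (r := fun z => 2 + (z - z₀) ^ 2 * Q z) (by fun_prop)
    (by
      filter_upwards [eventually_ne_punctured z₀] with z hz
      rw [hq]
      field_simp) hΦ hode (by
      intro n hn
      simp only [sub_self, ne_eq, OfNat.ofNat_ne_zero, not_false_eq_true, zero_pow, zero_mul,
        add_zero] at hn
      have hn2 : (n - 1) * (n - 4) * (n + 2) = 0 := by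
        have : ((n : ℂ) - 1) * (n - 4) * (n + 2) = 0 := by linear_combination hn
        exact_mod_cast this
      simp only [mul_eq_zero] at hn2
      lia)
  obtain ⟨c, d, F, hF, hΦF⟩ := exists_laurent_two hg h
  have hd := residue_eq_zero hQ hF (.of_forall hq) hΦF hode
  exact ⟨c, F, hF, by simpa only [hd, zero_div, add_zero] using hΦF⟩

/-- The regular part of `q(·; A)` at `-p`. -/
def qReg (τ p A z : ℂ) : ℂ :=
  2 * wp τ z + 3 / 4 * (wpReg τ (z + p) + wp τ (z - p))
    + A * (wzetaReg τ (z + p) - wzeta τ (z - p)) + Bc τ p A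

lemma qpot_eq_at_neg (τ p A z : ℂ) :
    qpot τ p A z = (3 / 4) / (z - -p) ^ 2 + A / (z - -p) + qReg τ p A z := by
  simp only [qpot, qReg, wp_eq τ (z + p), wzeta_eq τ (z + p), sub_neg_eq_add]
  ring

lemma qpot_neg {τ : ℂ} (hτ : 0 < τ.im) (p A z : ℂ) : qpot τ (-p) (-A) z = qpot τ p A z := by
  have h : 2 * -p = -(2 * p) := by ring
  simp only [qpot, Bc, sub_neg_eq_add, h, wp_neg hτ, wzeta_neg, ← sub_eq_add_neg]
  ring

lemma neg_sub_self_notMem {τ p : ℂ} (hp : 2 * p ∉ Lam τ) : -p - p ∉ Lam τ := by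
  rw [← neg_mem_Lam_iff]
  convert hp using 2; ring

lemma analyticAt_wzetaReg_add {τ : ℂ} (hτ : 0 < τ.im) (p : ℂ) :
    AnalyticAt ℂ (fun z => wzetaReg τ (z + p)) (-p) :=
  AnalyticAt.comp_add_right
    (by rw [neg_add_cancel]; exact analyticAt_wzetaReg hτ (zero_notMem_Lam' τ))

lemma analyticAt_wpReg_add {τ : ℂ} (hτ : 0 < τ.im) (p : ℂ) :
    AnalyticAt ℂ (fun z => wpReg τ (z + p)) (-p) :=
  AnalyticAt.comp_add_right
    (by rw [neg_add_cancel]; exact analyticAt_wpReg hτ (zero_notMem_Lam' τ))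

lemma analyticAt_qReg {τ p : ℂ} (hτ : 0 < τ.im) (hp : 2 * p ∉ Lam τ) (A : ℂ) :
    AnalyticAt ℂ (qReg τ p A) (-p) := by
  have hnp : -p ∉ Lam τ := fun h => notMem_Lam_of_two_mul hp (neg_mem_Lam_iff.1 h)
  have h1 := analyticAt_wp hτ hnp
  have h2 := (analyticAt_wp hτ (neg_sub_self_notMem hp)).comp_sub_right
  have h3 := (analyticAt_wzeta hτ (neg_sub_self_notMem hp)).comp_sub_right
  have h4 := analyticAt_wzetaReg_add hτ p
  have h5 := analyticAt_wpReg_add hτ p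
  unfold qReg
  fun_prop

lemma notMem_Sset {τ p z : ℂ} :
    z ∉ Sset τ p ↔ z ∉ Lam τ ∧ z - p ∉ Lam τ ∧ z + p ∉ Lam τ := by
  simp only [Sset, Set.mem_union, Set.mem_ofPred_eq, not_or, and_assoc]

lemma analyticAt_qpot {τ p z : ℂ} (hτ : 0 < τ.im) (hz : z ∉ Sset τ p) (A : ℂ) :
    AnalyticAt ℂ (qpot τ p A) z := by
  obtain ⟨h0, h1, h2⟩ := notMem_Sset.1 hz
  have a0 := analyticAt_wp hτ h0
  have a1 := (analyticAt_wp hτ h1).comp_sub_right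
  have a2 := (analyticAt_wp hτ h2).comp_add_right
  have a3 := (analyticAt_wzeta hτ h1).comp_sub_right
  have a4 := (analyticAt_wzeta hτ h2).comp_add_right
  unfold qpot
  fun_prop

lemma analyticAt_Phie {τ p z : ℂ} (hτ : 0 < τ.im) (hz : z ∉ Sset τ p) (A : ℂ) :
    AnalyticAt ℂ (Phie τ p A) z := by
  obtain ⟨h0, h1, h2⟩ := notMem_Sset.1 hz
  have a0 := analyticAt_wp hτ h0
  have a3 := (analyticAt_wzeta hτ h1).comp_sub_right
  have a4 := (analyticAt_wzeta hτ h2).comp_add_right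
  unfold Phie
  fun_prop

lemma eventually_notMem_Sset {τ : ℂ} (hτ : 0 < τ.im) (p z : ℂ) :
    ∀ᶠ w in 𝓝[≠] z, w ∉ Sset τ p := by
  filter_upwards [eventually_notMem_Lam hτ z, eventually_sub_notMem_Lam hτ z p,
    eventually_add_notMem_Lam hτ z p] with w h0 h1 h2
  exact notMem_Sset.2 ⟨h0, h1, h2⟩

lemma periodic_Lam {τ : ℂ} {Φ : ℂ → ℂ} (h1 : ∀ z, Φ (z + 1) = Φ z) (h2 : ∀ z, Φ (z + τ) = Φ z)
    {l : ℂ} (hl : l ∈ Lam τ) (z : ℂ) : Φ (z + l) = Φ z := by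
  obtain ⟨m, n, rfl⟩ := hl
  have p1 : Function.Periodic Φ 1 := h1
  have p2 : Function.Periodic Φ τ := h2
  rw [← add_assoc, p2.int_mul n, ← mul_one (m : ℂ), p1.int_mul m]

/-- An elliptic function with a double pole without residue on `Λ` and simple poles on `±p + Λ`
is a combination of `℘`, `ζ(· + p) - ζ(· - p)` and a constant. -/
lemma exists_eq_wp_add_wzeta {τ p : ℂ} (hτ : 0 < τ.im) (hp : 2 * p ∉ Lam τ) {Φ : ℂ → ℂ}
    (hper : ∀ l ∈ Lam τ, ∀ z, Φ (z + l) = Φ z) {a b c : ℂ} {F₀ F₁ F₂ : ℂ → ℂ}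
    (hF₀ : AnalyticAt ℂ F₀ 0) (hF₁ : AnalyticAt ℂ F₁ (-p)) (hF₂ : AnalyticAt ℂ F₂ p)
    (h₀ : Φ =ᶠ[𝓝[≠] 0] fun z => c / (z - 0) ^ 2 + F₀ z)
    (h₁ : Φ =ᶠ[𝓝[≠] (-p)] fun z => a / (z - -p) + F₁ z)
    (h₂ : Φ =ᶠ[𝓝[≠] p] fun z => b / (z - p) + F₂ z)
    (hreg : ∀ z ∉ Sset τ p, RemovableAt Φ z) :
    ∃ e : ℂ, ∀ z₀, ∀ᶠ z in 𝓝[≠] z₀,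
      Φ z = c * wp τ z + a * (wzeta τ (z + p) - wzeta τ (z - p)) + e := by
  have hp1 := notMem_Lam_of_two_mul hp
  have hnp : -p ∉ Lam τ := fun h => hp1 (neg_mem_Lam_iff.1 h)
  have h2p : p + p ∉ Lam τ := by rwa [← two_mul]
  set E : ℂ → ℂ := fun z => Φ z - c * wp τ z - a * wzeta τ (z + p) - b * wzeta τ (z - p) with hE
  choose! t ht using fun (l : ℂ) (hl : l ∈ Lam τ) => exists_quasiPeriod_wzeta hτ hl
  have hEper : ∀ l ∈ Lam τ, ∀ z, ∀ᶠ w in 𝓝[≠] z, E (w + l) = E w + -(a + b) * t l := by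
    intro l hl z
    filter_upwards [eventually_add_notMem_Lam hτ z p, eventually_sub_notMem_Lam hτ z p] with w k1 k2
    have e1 : w + l + p = w + p + l := by ring
    have e2 : w + l - p = w - p + l := by ring
    simp only [hE, wp_add hτ hl, e1, e2, ht l hl _ k1, ht l hl _ k2, hper l hl]
    ring
  have r0 : RemovableAt E 0 := by
    have a1 := AnalyticAt.comp_add_right (z := 0) (c := p)
      (by rw [zero_add]; exact analyticAt_wzeta hτ hp1)
    have a2 := AnalyticAt.comp_sub_right (z := 0) (c := p)
      (by rw [zero_sub]; exact analyticAt_wzeta hτ hnp)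
    have a3 := analyticAt_wpReg hτ (zero_notMem_Lam' τ)
    refine ⟨fun z => F₀ z - c * wpReg τ z - a * wzeta τ (z + p) - b * wzeta τ (z - p),
      by fun_prop, ?_⟩
    filter_upwards [h₀] with z hz
    simp only [hE, hz, wp_eq, sub_zero]
    ring
  have rn : RemovableAt E (-p) := by
    have a1 := analyticAt_wp hτ hnp
    have a2 := (analyticAt_wzeta hτ (neg_sub_self_notMem hp)).comp_sub_right
    have a3 := analyticAt_wzetaReg_add hτ p
    refine ⟨fun z => F₁ z - c * wp τ z - a * wzetaReg τ (z + p) - b * wzeta τ (z - p),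
      by fun_prop, ?_⟩
    filter_upwards [h₁] with z hz
    simp only [hE, hz, wzeta_eq τ (z + p), sub_neg_eq_add]
    ring
  have rp : RemovableAt E p := by
    have a1 := analyticAt_wp hτ hp1
    have a2 := (analyticAt_wzeta hτ h2p).comp_add_right
    have a3 : AnalyticAt ℂ (fun z => wzetaReg τ (z - p)) p :=
      AnalyticAt.comp_sub_right (by rw [sub_self]; exact analyticAt_wzetaReg hτ (zero_notMem_Lam' τ))
    refine ⟨fun z => F₂ z - c * wp τ z - a * wzeta τ (z + p) - b * wzetaReg τ (z - p),
      by fun_prop, ?_⟩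
    filter_upwards [h₂] with z hz
    simp only [hE, hz, wzeta_eq τ (z - p)]
    ring
  have hrem : ∀ z, RemovableAt E z := by
    intro z
    by_cases c0 : z ∈ Lam τ
    · simpa using r0.translate (hEper z c0 0)
    by_cases c1 : z - p ∈ Lam τ
    · simpa using rp.translate (hEper _ c1 p)
    by_cases c2 : z + p ∈ Lam τ
    · simpa using rn.translate (hEper _ c2 (-p))
    obtain ⟨g, hg, hΦg⟩ := hreg z (notMem_Sset.2 ⟨c0, c1, c2⟩)
    have k1 := (analyticAt_wzeta hτ c2).comp_add_right
    have k2 := (analyticAt_wzeta hτ c1).comp_sub_right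
    have k3 := analyticAt_wp hτ c0
    refine ⟨fun z => g z - c * wp τ z - a * wzeta τ (z + p) - b * wzeta τ (z - p),
      by fun_prop, ?_⟩
    filter_upwards [hΦg] with w hw
    simp only [hE, hw]
  obtain ⟨κ, e, he, hκ⟩ := affine_of_quasiPeriodic hτ hrem hEper
  have hab : a + b = 0 := by
    by_contra hab
    refine not_quasiPeriod_proportional (α := -κ / (a + b)) hτ fun l hl z hz => ?_
    rw [ht l hl z hz]
    have := hκ l hl
    field_simp
    linear_combination this
  have hκ0 : κ = 0 := by simpa [hab] using hκ 1 (one_mem_Lam τ)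
  refine ⟨e, fun z₀ => ?_⟩
  filter_upwards [he z₀] with z hz
  simp only [hE, hκ0] at hz
  linear_combination hz + wzeta τ (z - p) * hab

/-- The coefficients of an elliptic solution. -/
lemma coefficients_of_symSquareEq {τ p A a c e : ℂ} (hτ : 0 < τ.im) (hp : 2 * p ∉ Lam τ)
    {Φ : ℂ → ℂ} (hΦ : ∀ᶠ z in 𝓝[≠] (-p),
      Φ z = c * wp τ z + a * (wzeta τ (z + p) - wzeta τ (z - p)) + e)
    (hode : ∀ᶠ z in 𝓝[≠] (-p), SymSquareEq (qpot τ p A) Φ z) :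
    c * wp τ p + a * wzeta τ (2 * p) + e = -2 * A * a ∧
      -3 * c * wpdd τ p + 4 * A * c * wpd τ p - 8 * a * wpd τ p = 0 := by
  have hp1 := notMem_Lam_of_two_mul hp
  have hnp : -p ∉ Lam τ := fun h => hp1 (neg_mem_Lam_iff.1 h)
  have hm := neg_sub_self_notMem hp
  have hz0 := zero_notMem_Lam' τ
  set F : ℂ → ℂ := fun z => c * wp τ z + a * (wzetaReg τ (z + p) - wzeta τ (z - p)) + e with hF
  have a1 := analyticAt_wp hτ hnp
  have a2 := (analyticAt_wzeta hτ hm).comp_sub_right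
  have a3 := analyticAt_wzetaReg_add hτ p
  have hFan : AnalyticAt ℂ F (-p) := by fun_prop
  have hΦF : Φ =ᶠ[𝓝[≠] (-p)] fun z => a / (z - -p) + F z := by
    filter_upwards [hΦ] with z hz
    simp only [hz, hF, wzeta_eq τ (z + p), sub_neg_eq_add]
    ring
  obtain ⟨k1, k2⟩ := frobenius_relations (analyticAt_qReg hτ hp A) hFan
    (.of_forall (qpot_eq_at_neg τ p A)) hΦF hode
  have e2p : -p - p = -(2 * p) := by ring
  have hF' : deriv F =ᶠ[𝓝 (-p)]
      fun z => c * wpd τ z + a * (-wpReg τ (z + p) + wp τ (z - p)) := by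
    have n1 : ∀ᶠ z in 𝓝 (-p), z ∉ Lam τ := (isOpen_compl_Lam hτ).mem_nhds hnp
    have n2 : ∀ᶠ z in 𝓝 (-p), z - p ∉ Lam τ :=
      (continuous_id.sub continuous_const).continuousAt.eventually
        ((isOpen_compl_Lam hτ).mem_nhds hm)
    have n3 : ∀ᶠ z in 𝓝 (-p), z + p ∉ Lam' τ :=
      (continuous_id.add continuous_const).continuousAt.eventually
        ((isOpen_compl_Lam' hτ).mem_nhds (by simpa using hz0))
    filter_upwards [n1, n2, n3] with z h1 h2 h3
    have := (((hasDerivAt_wp hτ h1).const_mul c).add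
      ((((hasDerivAt_wzetaReg hτ h3).comp_add_const z p).sub
        ((hasDerivAt_wzeta hτ h2).comp_sub_const z p)).const_mul a)).add_const e
    refine this.deriv.trans (by ring)
  have hR0 : HasDerivAt (wpReg τ) 0 (-p + p) := by
    rw [neg_add_cancel]
    have h := (analyticAt_wpReg hτ hz0).differentiableAt.hasDerivAt
    have hn := deriv_comp_neg (wpReg τ) 0
    have en : (fun x => wpReg τ (-x)) = wpReg τ := funext (wpReg_neg hτ)
    rw [en, neg_zero] at hn
    have : deriv (wpReg τ) 0 = 0 := by linear_combination hn / 2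
    rwa [this] at h
  have hR := hR0.comp_add_const (-p) p
  have hW := (hasDerivAt_wp hτ hm).comp_sub_const (-p) p
  have hZ := (hasDerivAt_wzeta hτ hm).comp_sub_const (-p) p
  have hZR : HasDerivAt (fun z => wzetaReg τ (z + p)) 0 (-p) := by
    have : HasDerivAt (wzetaReg τ) 0 (-p + p) := by
      rw [neg_add_cancel]
      simpa [wpReg_zero hτ] using hasDerivAt_wzetaReg hτ hz0
    exact this.comp_add_const (-p) p
  have wpdd_neg : wpdd τ (-p) = wpdd τ p := by
    have h := deriv_comp_neg (wpd τ) p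
    have en : (fun x => wpd τ (-x)) = fun x => -wpd τ x := funext (wpd_neg hτ)
    rw [en, deriv.fun_neg] at h
    exact (neg_injective h).symm
  have hF'' : deriv (deriv F) (-p) = c * wpdd τ p - a * wpd τ (2 * p) := by
    rw [hF'.deriv_eq, ← wpdd_neg]
    have hd : HasDerivAt (wpd τ) (wpdd τ (-p)) (-p) :=
      (analyticAt_wpd hτ hnp).differentiableAt.hasDerivAt
    refine ((hd.const_mul c).add ((hR.neg.add hW).const_mul a)).deriv.trans ?_
    rw [e2p, wpd_neg hτ]
    ring
  have hQ' : deriv (qReg τ p A) (-p) =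
      -2 * wpd τ p - 3 / 4 * wpd τ (2 * p) + A * wp τ (2 * p) := by
    have hd := ((((hasDerivAt_wp hτ hnp).const_mul 2).add ((hR.add hW).const_mul (3 / 4))).add
      ((hZR.sub hZ).const_mul A)).add_const (Bc τ p A)
    refine hd.deriv.trans ?_
    rw [e2p, wpd_neg hτ, wpd_neg hτ, wp_neg hτ]
    ring
  rw [hF'', hQ', hF'.eq_of_nhds, neg_add_cancel, wpReg_zero hτ, e2p, wp_neg hτ, wpd_neg hτ] at k2
  simp only [hF, neg_add_cancel, wzetaReg_zero, e2p, wzeta_neg, wp_neg hτ] at k1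
  exact ⟨by linear_combination k1, by linear_combination k2⟩

/-- any doubly periodic meromorphic solution of the second symmetric
product equation is a constant multiple of `Φ_e(·; A)`. -/
theorem stmt_1 (τ p : ℂ) (hτ : 0 < τ.im) (hp : 2 * p ∉ Lam τ) (A : ℂ)
    (Φ : ℂ → ℂ) (hmero : MeromorphicOn Φ Set.univ)
    (hper1 : ∀ z, Φ (z + 1) = Φ z) (hper2 : ∀ z, Φ (z + τ) = Φ z)
    (hODE : ∀ z ∉ Sset τ p, AnalyticAt ℂ Φ z →
      deriv (deriv (deriv Φ)) z - 4 * qpot τ p A z * deriv Φ z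
        - 2 * deriv (qpot τ p A) z * Φ z = 0) :
    ∃ k : ℂ, ∀ z ∉ Sset τ p, AnalyticAt ℂ Φ z → Φ z = k * Phie τ p A z := by
  have hp1 := notMem_Lam_of_two_mul hp
  have hnp : -p ∉ Lam τ := fun h => hp1 (neg_mem_Lam_iff.1 h)
  have hmer : ∀ z, MeromorphicAt Φ z := fun z => hmero z trivial
  have hode : ∀ z, ∀ᶠ w in 𝓝[≠] z, SymSquareEq (qpot τ p A) Φ w := by
    intro z
    filter_upwards [eventually_notMem_Sset hτ p z, (hmer z).eventually_analyticAt] with w h1 h2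
    exact hODE w h1 h2
  obtain ⟨c, F₀, hF₀, h₀⟩ := exists_double_pole_of_symSquareEq
    (Q := fun z => 2 * wpReg τ z + 3 / 4 * (wp τ (z + p) + wp τ (z - p))
      + A * (wzeta τ (z + p) - wzeta τ (z - p)) + Bc τ p A) (hmer 0) (by
      have a1 := AnalyticAt.comp_add_right (z := 0) (c := p)
        (by rw [zero_add]; exact analyticAt_wzeta hτ hp1)
      have a2 := AnalyticAt.comp_sub_right (z := 0) (c := p)
        (by rw [zero_sub]; exact analyticAt_wzeta hτ hnp)
      have a3 := AnalyticAt.comp_add_right (z := 0) (c := p)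
        (by rw [zero_add]; exact analyticAt_wp hτ hp1)
      have a4 := AnalyticAt.comp_sub_right (z := 0) (c := p)
        (by rw [zero_sub]; exact analyticAt_wp hτ hnp)
      have a5 := analyticAt_wpReg hτ (zero_notMem_Lam' τ)
      fun_prop)
    (fun z => by rw [qpot, wp_eq τ z, sub_zero]; ring) (hode 0)
  obtain ⟨a, F₁, hF₁, h₁⟩ := exists_simple_pole_of_symSquareEq (hmer (-p))
    (analyticAt_qReg hτ hp A) (qpot_eq_at_neg τ p A) (hode (-p))
  have hp' : 2 * -p ∉ Lam τ := fun h => hp (neg_mem_Lam_iff.1 (by convert h using 1; ring))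
  obtain ⟨b, F₂, hF₂, h₂⟩ := exists_simple_pole_of_symSquareEq (hmer (- -p))
    (analyticAt_qReg hτ hp' (-A))
    (fun z => (qpot_neg hτ p A z).symm.trans (qpot_eq_at_neg τ (-p) (-A) z)) (hode _)
  rw [neg_neg] at hF₂ h₂
  obtain ⟨e, he⟩ := exists_eq_wp_add_wzeta hτ hp (fun l hl => periodic_Lam hper1 hper2 hl)
    hF₀ hF₁ hF₂ h₀ h₁ h₂
    (fun z hz => (hmer z).removableAt_of_symSquareEq (analyticAt_qpot hτ hz A) (hode z))
  obtain ⟨k1, k2⟩ := coefficients_of_symSquareEq hτ hp (he (-p)) (hode (-p))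
  obtain ⟨hne, hdup⟩ := wzeta_two_mul hτ hp
  have ha : a = c * (A / 2 - 3 * wpdd τ p / (8 * wpd τ p)) := by
    field_simp
    linear_combination -2 * k2
  have hec : e = -2 * A * a - c * wp τ p - a * wzeta τ (2 * p) := by linear_combination k1
  refine ⟨c, fun z hz hΦz => ?_⟩
  refine eq_of_punctured (g := fun z => c * Phie τ p A z) hΦz.continuousAt
    (continuousAt_const.mul (analyticAt_Phie hτ hz A).continuousAt) ?_
  filter_upwards [he z] with w hw
  rw [hw, Phie, hec, hdup, ha]
  field_simp
  ring
end
end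

section
/- Let A₀ = 3℘''(p)/(4℘'(p)). Then the spectral polynomial value satisfies Q(A₀) = −Y₁(A₀) Y₂(A₀) = −℘'(p)²; in particular Q(A₀) ≠ 0, since ℘'(p) ≠ 0 when 2p ∉ Λ_τ. -/
open Complex Filter Topology

noncomputable section

open scoped PeriodPair

namespace PeriodPair

variable (L : PeriodPair)

/-- `℘` is not constant on the complement of its lattice. -/
lemma not_eqOn_weierstrassP_const (e : ℂ) :
    ¬ Set.EqOn ℘[L] (fun _ ↦ e) (L.lattice : Set ℂ)ᶜ := by
  intro h
  have hord := L.order_weierstrassP 0 (zero_mem _)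
  have hev : ℘[L] =ᶠ[𝓝[≠] 0] fun _ ↦ e := by
    filter_upwards [self_mem_nhdsWithin,
      mem_nhdsWithin_of_mem_nhds (L.compl_lattice_sdiff_singleton_mem_nhds 0)] with z hz hz'
    exact h (by simp_all)
  rw [meromorphicOrderAt_congr hev] at hord
  have hnonneg := (analyticAt_const (𝕜 := ℂ) (v := e) (x := (0 : ℂ))).meromorphicOrderAt_nonneg
  rw [hord] at hnonneg
  exact absurd hnonneg (by decide)

/-- The values of `℘` off the lattice are isolated. -/
lemma not_frequently_weierstrassP_eq {x : ℂ} (hx : x ∉ L.lattice) (e : ℂ) :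
    ¬ ∃ᶠ z in 𝓝[≠] x, ℘[L] z = e := by
  intro h
  have hcount : (L.lattice : Set ℂ).Countable :=
    L.latticeEquivProd.toEquiv.countable_iff.mpr inferInstance
  have hconn := hcount.isPathConnected_compl_of_one_lt_rank
    (by rw [Complex.rank_real_complex]; norm_num)
  exact L.not_eqOn_weierstrassP_const e <|
    L.analyticOnNhd_weierstrassP.eqOn_of_preconnected_of_frequently_eq
      analyticOnNhd_const hconn.isConnected.isPreconnected hx h

/-- The product `(℘(z) - ℘(p)) (℘(z + p) - ℘(p))`, given the value `c` at its singularities. -/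
def shiftProduct (p c z : ℂ) : ℂ :=
  letI := Classical.propDecidable
  if z ∈ L.lattice ∨ z + p ∈ L.lattice then c
  else (℘[L] z - ℘[L] p) * (℘[L] (z + p) - ℘[L] p)

lemma shiftProduct_of_notMem (p c : ℂ) {z : ℂ} (hz : z ∉ L.lattice) (hzp : z + p ∉ L.lattice) :
    L.shiftProduct p c z = (℘[L] z - ℘[L] p) * (℘[L] (z + p) - ℘[L] p) := by
  simp [shiftProduct, hz, hzp]

lemma shiftProduct_add_coe (p c z : ℂ) (l : L.lattice) :
    L.shiftProduct p c (z + l) = L.shiftProduct p c z := by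
  have h (w : ℂ) : w + l ∈ L.lattice ↔ w ∈ L.lattice :=
    L.lattice.toAddSubgroup.add_mem_cancel_right l.2
  simp only [shiftProduct, add_right_comm z _ p, weierstrassP_add_coe]
  congr 1
  rw [h, add_right_comm, h]

lemma shiftProduct_neg_sub (p c z : ℂ) :
    L.shiftProduct p c (-p - z) = L.shiftProduct p c z := by
  have h₁ : -p - z = -(z + p) := by ring
  have h₂ : -p - z + p = -z := by ring
  simp only [shiftProduct]
  congr 1
  · rw [h₂, h₁, neg_mem_iff, neg_mem_iff, or_comm]
  · rw [h₂, h₁, weierstrassP_neg, weierstrassP_neg, mul_comm]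

/-- If `℘'(p) = 0`, the shift product extends analytically across the origin. -/
lemma exists_analyticAt_shiftProduct {p : ℂ} (hp : p ∉ L.lattice) (hd : ℘'[L] p = 0) :
    ∃ c, AnalyticAt ℂ (L.shiftProduct p c) 0 := by
  have han := L.analyticOnNhd_weierstrassP p hp
  have hfan : AnalyticAt ℂ (fun z ↦ ℘[L] z - ℘[L] p) p := by fun_prop
  have hle : ((2 : ℕ) : ℕ∞) ≤ analyticOrderAt (fun z ↦ ℘[L] z - ℘[L] p) p := by
    rw [natCast_le_analyticOrderAt_iff_iteratedDeriv_eq_zero hfan]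
    intro i hi
    interval_cases i
    · simp
    · simp [hd]
  obtain ⟨g, hg, hfg⟩ := (natCast_le_analyticOrderAt hfan).mp hle
  refine ⟨g p, ?_⟩
  have hg' : AnalyticAt ℂ (fun z ↦ g (z + p)) 0 :=
    AnalyticAt.fun_comp (g := g) (f := (· + p)) (by simpa using hg) (by fun_prop)
  have hk : AnalyticAt ℂ
      (fun z ↦ (z ^ 2 * ℘[L - (0 : ℂ)] z + 1 - ℘[L] p * z ^ 2) * g (z + p)) 0 :=
    AnalyticAt.mul (by fun_prop) hg'
  refine hk.congr ?_
  have htend : Tendsto (· + p) (𝓝 (0 : ℂ)) (𝓝 p) := by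
    simpa using (continuous_add_const p).tendsto (0 : ℂ)
  filter_upwards [L.compl_lattice_sdiff_singleton_mem_nhds 0, htend.eventually hfg,
    htend.eventually (L.isClosed_lattice.isOpen_compl.mem_nhds hp)] with z hz hzg hzp
  by_cases hz0 : z = 0
  · simp [shiftProduct, hz0]
  have hzL : z ∉ L.lattice := by simp_all
  rw [L.shiftProduct_of_notMem _ _ hzL hzp, hzg]
  have := L.weierstrassPExcept_add 0 z
  simp only [ZeroMemClass.coe_zero, sub_zero] at this
  rw [← this]
  simp
  field_simp

lemma differentiable_shiftProduct {p c : ℂ} (h₀ : AnalyticAt ℂ (L.shiftProduct p c) 0) :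
    Differentiable ℂ (L.shiftProduct p c) := by
  have hlat (x : ℂ) (hx : x ∈ L.lattice) : DifferentiableAt ℂ (L.shiftProduct p c) x := by
    have heq : L.shiftProduct p c = fun z ↦ L.shiftProduct p c (z - x) := by
      ext z
      simpa using L.shiftProduct_add_coe p c (z - x) ⟨x, hx⟩
    rw [heq]
    exact DifferentiableAt.comp x (g := L.shiftProduct p c) (f := (· - x))
      (by simpa using h₀.differentiableAt) (by fun_prop)
  intro x
  by_cases hx : x ∈ L.lattice
  · exact hlat x hx
  by_cases hxp : x + p ∈ L.lattice
  · have heq : L.shiftProduct p c = fun z ↦ L.shiftProduct p c (-p - z) :=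
      funext fun z ↦ (L.shiftProduct_neg_sub p c z).symm
    rw [heq]
    refine DifferentiableAt.comp x (g := L.shiftProduct p c) (f := (-p - ·))
      (hlat _ ?_) (by fun_prop)
    rw [show -p - x = -(x + p) by ring]
    exact neg_mem hxp
  · have h₁ := (L.analyticOnNhd_weierstrassP x hx).differentiableAt
    have h₂ : DifferentiableAt ℂ (fun z ↦ ℘[L] (z + p)) x :=
      DifferentiableAt.comp x (g := ℘[L]) (f := (· + p))
        (L.analyticOnNhd_weierstrassP _ hxp).differentiableAt (by fun_prop)
    have h₃ : DifferentiableAt ℂ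
        (fun z ↦ (℘[L] z - ℘[L] p) * (℘[L] (z + p) - ℘[L] p)) x := by fun_prop
    refine h₃.congr_of_eventuallyEq ?_
    filter_upwards [L.isClosed_lattice.isOpen_compl.mem_nhds hx,
      (continuous_add_const p).continuousAt.eventually
        (L.isClosed_lattice.isOpen_compl.mem_nhds hxp)] with z hz hzp
    exact L.shiftProduct_of_notMem _ _ hz hzp

/-- The zeros of `℘'` off the lattice are half-periods. -/
theorem derivWeierstrassP_ne_zero {p : ℂ} (hp : 2 * p ∉ L.lattice) : ℘'[L] p ≠ 0 := by
  intro hd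
  have hpL : p ∉ L.lattice := fun h ↦ hp (two_mul p ▸ add_mem h h)
  rw [two_mul] at hp
  obtain ⟨c, hc⟩ := L.exists_analyticAt_shiftProduct hpL hd
  have hdiff := L.differentiable_shiftProduct hc
  have hbdd := (IsZLattice.isCompact_range_of_periodic L.lattice _ hdiff.continuous
    fun z w hw ↦ L.shiftProduct_add_coe p c z ⟨w, hw⟩).isBounded
  have hzero (z : ℂ) : L.shiftProduct p c z = 0 := by
    rw [hdiff.apply_eq_apply_of_bounded hbdd z p, L.shiftProduct_of_notMem _ _ hpL hp]
    simp
  have hshift : Tendsto (· + p) (𝓝[≠] p) (𝓝[≠] (p + p)) :=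
    ((continuous_add_const p).tendsto p).inf (by simp)
  have hev : ∀ᶠ z in 𝓝[≠] p, ℘[L] z = ℘[L] p ∨ ℘[L] (z + p) = ℘[L] p := by
    filter_upwards [mem_nhdsWithin_of_mem_nhds (L.isClosed_lattice.isOpen_compl.mem_nhds hpL),
      (hshift.mono_right nhdsWithin_le_nhds).eventually
        (L.isClosed_lattice.isOpen_compl.mem_nhds hp)] with z hz hzp
    have h := hzero z
    rwa [L.shiftProduct_of_notMem _ _ hz hzp, mul_eq_zero, sub_eq_zero, sub_eq_zero] at h
  rcases Filter.frequently_or_distrib.mp hev.frequently with h | h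
  · exact L.not_frequently_weierstrassP_eq hpL _ h
  · exact L.not_frequently_weierstrassP_eq hp _ (hshift.frequently h)

/-- The period pair `(1, τ)`. -/
def ofIm (τ : ℂ) (hτ : 0 < τ.im) : PeriodPair where
  ω₁ := 1
  ω₂ := τ
  indep := by
    rw [LinearIndependent.pair_iff]
    intro s t h
    have him := congrArg Complex.im h
    have hre := congrArg Complex.re h
    have ht : t = 0 := by simpa [hτ.ne'] using him
    subst ht
    simpa using hre

lemma coe_lattice_ofIm (τ : ℂ) (hτ : 0 < τ.im) : ((ofIm τ hτ).lattice : Set ℂ) = Lam τ := by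
  ext z
  simp [mem_lattice, Lam, ofIm, eq_comm]

lemma wp_eq_weierstrassP (τ : ℂ) (hτ : 0 < τ.im) : wp τ = ℘[ofIm τ hτ] := by
  classical
  ext z
  have h := (ofIm τ hτ).weierstrassPExcept_add 0 z
  simp only [ZeroMemClass.coe_zero, sub_zero] at h
  rw [← h, wp, weierstrassPExcept, add_comm]
  have hsub := tsum_subtype (Lam' τ) fun l ↦ 1 / (z - l) ^ 2 - 1 / l ^ 2
  have hlat := tsum_subtype ((ofIm τ hτ).lattice : Set ℂ) fun l ↦
    if l = 0 then (0 : ℂ) else 1 / (z - l) ^ 2 - 1 / l ^ 2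
  rw [hsub]
  simp only [SetLike.coe_sort_coe] at hlat
  rw [hlat, coe_lattice_ofIm]
  have hind : (Lam' τ).indicator (fun l ↦ 1 / (z - l) ^ 2 - 1 / l ^ 2) =
      (Lam τ).indicator fun l ↦
        if l = 0 then (0 : ℂ) else 1 / (z - l) ^ 2 - 1 / l ^ 2 := by
    ext l
    by_cases hl : l ∈ Lam τ <;> by_cases hl0 : l = 0 <;>
      simp [Set.indicator, Lam', hl, hl0]
  rw [hind]
  simp

end PeriodPair

lemma wpd_ne_zero {τ p : ℂ} (hτ : 0 < τ.im) (hp : 2 * p ∉ Lam τ) : wpd τ p ≠ 0 := by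
  rw [wpd, PeriodPair.wp_eq_weierstrassP τ hτ, PeriodPair.deriv_weierstrassP]
  apply PeriodPair.derivWeierstrassP_ne_zero
  rwa [← SetLike.mem_coe, PeriodPair.coe_lattice_ofIm]

/-- for `A₀ = 3℘''(p)/(4℘'(p))` the spectral polynomial satisfies
`Q(A₀) = −℘'(p)² ≠ 0`. -/
theorem stmt_3 (τ p : ℂ) (hτ : 0 < τ.im) (hp : 2 * p ∉ Lam τ) :
    -(Y1 τ p (3 * wpdd τ p / (4 * wpd τ p)) * Y2 τ p (3 * wpdd τ p / (4 * wpd τ p)))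
        = -(wpd τ p) ^ 2 ∧
      -(Y1 τ p (3 * wpdd τ p / (4 * wpd τ p)) * Y2 τ p (3 * wpdd τ p / (4 * wpd τ p)))
        ≠ 0 := by
  have hd := wpd_ne_zero hτ hp
  have h₁ : Y1 τ p (3 * wpdd τ p / (4 * wpd τ p)) = wpd τ p / 2 := by
    rw [Y1]
    field_simp
    ring
  have h₂ : Y2 τ p (3 * wpdd τ p / (4 * wpd τ p)) = 2 * wpd τ p := by
    rw [Y2]
    field_simp
    ring
  have h : -(wpd τ p / 2 * (2 * wpd τ p)) = -(wpd τ p) ^ 2 := by ring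
  rw [h₁, h₂, h]
  exact ⟨rfl, neg_ne_zero.mpr (pow_ne_zero 2 hd)⟩
end
end
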